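/- Let N ≥ 2, let Ω ⊂ ℝᴺ be a bounded open set, and let T > 0. Let ρ ∈ L²((0,T)×Ω), f ∈ L¹((0,T)×Ω), and let u : (0,T)×Ω → ℝᴺ be measurable such that for almost every t ∈ (0,T) the function u(t,·) belongs to W₀^{1,2}(Ω;ℝᴺ), i.e. the closure of C_c^∞(Ω;ℝᴺ) with respect to the norm v ↦ (∫_Ω |v|² + |Dv|² dx)^{1/2}, and such that ∫₀ᵀ ∫_Ω |u|² + |Du|² dx dt < ∞, where Du(t,·) denotes the weak derivative of u(t,·). Assume that ∂_t ρ + div(ρu) = f in the sense of distributions on (0,T)×Ω, i.e. for every ψ ∈ C_c^∞((0,T)×Ω): ∫₀ᵀ ∫_Ω ρ ∂_t ψ + ρ u·∇ψ + f ψ dx dt = 0. Then, denoting by ρ̃, ũ, f̃ the extensions of ρ, u, f by zero to (0,T)×ℝᴺ, one has ∂_t ρ̃ + div(ρ̃ũ) = f̃ in the sense of distributions on (0,T)×ℝᴺ, i.e. for every ψ ∈ C_c^∞((0,T)×ℝᴺ): ∫₀ᵀ ∫_{ℝᴺ} ρ̃ ∂_t ψ + ρ̃ ũ·∇ψ + f̃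 ψ dx dt = 0. -/

import Mathlib

open MeasureTheory Filter Topology
open scoped ENNReal

/-- A smooth vector field compactly supported inside `Ω`. -/
def IsTestVectorField {N : ℕ} (Ω : Set (EuclideanSpace ℝ (Fin N)))
    (φ : EuclideanSpace ℝ (Fin N) → EuclideanSpace ℝ (Fin N)) : Prop :=
  ContDiff ℝ (⊤ : ℕ∞) φ ∧ HasCompactSupport φ ∧ tsupport φ ⊆ Ω

/-- `v ∈ W₀^{1,2}(Ω;ℝᴺ)` with weak derivative `Dv`: `v` is the limit, in the
`W^{1,2}(Ω)` norm, of a sequence of smooth vector fields compactly supported in `Ω`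
(whose derivatives converge in `L²(Ω)` to `Dv`). -/
def MemW012 {N : ℕ} (Ω : Set (EuclideanSpace ℝ (Fin N)))
    (v : EuclideanSpace ℝ (Fin N) → EuclideanSpace ℝ (Fin N))
    (Dv : EuclideanSpace ℝ (Fin N) →
      (EuclideanSpace ℝ (Fin N) →L[ℝ] EuclideanSpace ℝ (Fin N))) : Prop :=
  ∃ φ : ℕ → EuclideanSpace ℝ (Fin N) → EuclideanSpace ℝ (Fin N),
    (∀ n, IsTestVectorField Ω (φ n)) ∧
    Tendsto (fun n => ∫ x in Ω, ‖φ n x - v x‖ ^ 2) atTop (𝓝 0) ∧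
    Tendsto (fun n => ∫ x in Ω, ‖fderiv ℝ (φ n) x - Dv x‖ ^ 2) atTop (𝓝 0)

theorem ENNReal.sq_lintegral_mul_le {α : Type*} [MeasurableSpace α] (μ : Measure α)
    {f g : α → ℝ≥0∞} (hf : AEMeasurable f μ) (hg : AEMeasurable g μ) :
    (∫⁻ a, f a * g a ∂μ) ^ 2 ≤ (∫⁻ a, f a ^ 2 ∂μ) * ∫⁻ a, g a ^ 2 ∂μ := by
  have h := ENNReal.lintegral_mul_le_Lp_mul_Lq μ Real.HolderConjugate.two_two hf hg
  simp only [Pi.mul_apply, ENNReal.rpow_two] at h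
  calc _ ≤ _ := pow_le_pow_left' h 2
    _ = _ := by
      rw [mul_pow, ← ENNReal.rpow_two, ← ENNReal.rpow_mul, ← ENNReal.rpow_two, ← ENNReal.rpow_mul]
      norm_num

theorem ENNReal.sq_lintegral_weighted_le {α : Type*} [MeasurableSpace α] (μ : Measure α)
    {k g : α → ℝ≥0∞} (hk : AEMeasurable k μ) (hg : AEMeasurable g μ) :
    (∫⁻ a, k a * g a ∂μ) ^ 2 ≤ (∫⁻ a, k a ∂μ) * ∫⁻ a, k a * g a ^ 2 ∂μ := by
  have hs : ∀ c : ℝ≥0∞, c ^ (1 / 2 : ℝ) * c ^ (1 / 2 : ℝ) = c := fun c => by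
    rw [← ENNReal.rpow_add_of_nonneg _ _ (by norm_num) (by norm_num)]
    norm_num
  have h := ENNReal.sq_lintegral_mul_le μ (f := fun a => k a ^ (1 / 2 : ℝ))
    (g := fun a => k a ^ (1 / 2 : ℝ) * g a) (hk.pow_const _) ((hk.pow_const _).mul hg)
  simpa only [← mul_assoc, hs, mul_pow, sq (_ ^ (1 / 2 : ℝ))] using h

theorem ENNReal.add_sq_le_two_mul (a b : ℝ≥0∞) : (a + b) ^ 2 ≤ 2 * (a ^ 2 + b ^ 2) := by
  have h := ENNReal.rpow_add_le_mul_rpow_add_rpow a b (p := 2) (by norm_num)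
  norm_num at h
  exact_mod_cast h

section Translation

variable {E F : Type*} [NormedAddCommGroup E] [NormedSpace ℝ E] [FiniteDimensional ℝ E]
  [MeasurableSpace E] [BorelSpace E] [NormedAddCommGroup F] [NormedSpace ℝ F] [CompleteSpace F]

omit [FiniteDimensional ℝ E] [MeasurableSpace E] [BorelSpace E] in
theorem enorm_sub_sq_le_lintegral_fderiv {φ : E → F} (hφ : ContDiff ℝ 1 φ) (x h : E) :
    ‖φ (x + h) - φ x‖ₑ ^ 2
      ≤ ‖h‖ₑ ^ 2 * ∫⁻ s in Set.Ioc (0 : ℝ) 1, ‖fderiv ℝ φ (x + s • h)‖ₑ ^ 2 := by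
  have hc : Continuous fun s : ℝ => fderiv ℝ φ (x + s • h) :=
    (hφ.continuous_fderiv one_ne_zero).comp (by fun_prop)
  have hd : ∀ s : ℝ, HasDerivAt (fun s : ℝ => φ (x + s • h)) (fderiv ℝ φ (x + s • h) h) s := by
    intro s
    have h1 : HasDerivAt (fun s : ℝ => x + s • h) h s := by
      simpa using ((hasDerivAt_id s).smul_const h).const_add x
    exact ((hφ.differentiable one_ne_zero) _).hasFDerivAt.comp_hasDerivAt s h1
  have hftc : φ (x + h) - φ x = ∫ s in Set.Ioc (0 : ℝ) 1, fderiv ℝ φ (x + s • h) h := by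
    rw [← intervalIntegral.integral_of_le zero_le_one,
      intervalIntegral.integral_eq_sub_of_hasDerivAt (fun s _ => hd s)
        ((hc.clm_apply continuous_const).intervalIntegrable _ _)]
    simp
  have hle : ‖φ (x + h) - φ x‖ₑ
      ≤ ∫⁻ s in Set.Ioc (0 : ℝ) 1, 1 * (‖fderiv ℝ φ (x + s • h)‖ₑ * ‖h‖ₑ) := by
    rw [hftc]
    refine (enorm_integral_le_lintegral_enorm _).trans (lintegral_mono fun s => ?_)
    simpa using ContinuousLinearMap.le_opENorm _ _
  have hm : AEMeasurable (fun s : ℝ => ‖fderiv ℝ φ (x + s • h)‖ₑ * ‖h‖ₑ)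
      (volume.restrict (Set.Ioc (0 : ℝ) 1)) :=
    (hc.enorm.measurable.mul_const _).aemeasurable
  calc _ ≤ _ := pow_le_pow_left' hle 2
    _ ≤ _ := ENNReal.sq_lintegral_weighted_le _ aemeasurable_const hm
    _ = _ := by
      simp only [lintegral_one, one_mul, mul_pow, Measure.restrict_apply_univ, Real.volume_Ioc]
      rw [lintegral_mul_const _ (hc.enorm.measurable.pow_const _)]
      simp [mul_comm]

theorem lintegral_enorm_translate_sub_sq_le (μ : Measure E) [μ.IsAddHaarMeasure] {φ : E → F}
    (hφ : ContDiff ℝ 1 φ) (h : E) :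
    ∫⁻ x, ‖φ (x + h) - φ x‖ₑ ^ 2 ∂μ ≤ ‖h‖ₑ ^ 2 * ∫⁻ x, ‖fderiv ℝ φ x‖ₑ ^ 2 ∂μ := by
  have hc : Continuous fun p : E × ℝ => fderiv ℝ φ (p.1 + p.2 • h) :=
    (hφ.continuous_fderiv one_ne_zero).comp (by fun_prop)
  calc ∫⁻ x, ‖φ (x + h) - φ x‖ₑ ^ 2 ∂μ
      ≤ ∫⁻ x, ‖h‖ₑ ^ 2 * (∫⁻ s in Set.Ioc (0 : ℝ) 1, ‖fderiv ℝ φ (x + s • h)‖ₑ ^ 2) ∂μ :=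
        lintegral_mono fun x => enorm_sub_sq_le_lintegral_fderiv hφ x h
    _ = ‖h‖ₑ ^ 2 * ∫⁻ x, (∫⁻ s in Set.Ioc (0 : ℝ) 1, ‖fderiv ℝ φ (x + s • h)‖ₑ ^ 2) ∂μ :=
        lintegral_const_mul' _ _ (by finiteness)
    _ = ‖h‖ₑ ^ 2 * ∫⁻ s in Set.Ioc (0 : ℝ) 1, ∫⁻ x, ‖fderiv ℝ φ (x + s • h)‖ₑ ^ 2 ∂μ := by
        rw [lintegral_lintegral_swap (hc.enorm.measurable.pow_const _).aemeasurable]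
    _ = ‖h‖ₑ ^ 2 * ∫⁻ x, ‖fderiv ℝ φ x‖ₑ ^ 2 ∂μ := by
        simp [lintegral_add_right_eq_self (fun x => ‖fderiv ℝ φ x‖ₑ ^ 2)]

end Translation

section SquareIntegrable

variable {α F : Type*} [MeasurableSpace α] {μ : Measure α} [NormedAddCommGroup F]

theorem eLpNorm_two_sq_eq_lintegral (g : α → F) : eLpNorm g 2 μ ^ 2 = ∫⁻ a, ‖g a‖ₑ ^ 2 ∂μ := by
  rw [eLpNorm_eq_lintegral_rpow_enorm_toReal (by norm_num) (by norm_num), ← ENNReal.rpow_two,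
    ← ENNReal.rpow_mul]
  norm_num

theorem eLpNorm_two_eq_lintegral_rpow (g : α → F) :
    eLpNorm g 2 μ = (∫⁻ a, ‖g a‖ₑ ^ 2 ∂μ) ^ (1 / 2 : ℝ) := by
  rw [eLpNorm_eq_lintegral_rpow_enorm_toReal (by norm_num) (by norm_num)]
  norm_num

theorem memLp_two_iff_lintegral {g : α → F} (hg : AEStronglyMeasurable g μ) :
    MemLp g 2 μ ↔ ∫⁻ a, ‖g a‖ₑ ^ 2 ∂μ < ⊤ := by
  rw [← eLpNorm_two_sq_eq_lintegral, MemLp]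
  simp [hg]

theorem MeasureTheory.MemLp.ofReal_integral_norm_sq {g : α → F} (hg : MemLp g 2 μ) :
    ENNReal.ofReal (∫ a, ‖g a‖ ^ 2 ∂μ) = eLpNorm g 2 μ ^ 2 := by
  rw [eLpNorm_two_sq_eq_lintegral, ofReal_integral_eq_lintegral_ofReal
    (by simpa using hg.integrable_norm_pow (p := 2) (by norm_num))
    (Eventually.of_forall fun _ => by positivity)]
  simp_rw [ENNReal.ofReal_pow (norm_nonneg _), ofReal_norm]

theorem tendsto_eLpNorm_two_of_tendsto_integral {ι : Type*} {l : Filter ι} {g : ι → α → F}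
    (hg : ∀ i, MemLp (g i) 2 μ) (h : Tendsto (fun i => ∫ a, ‖g i a‖ ^ 2 ∂μ) l (𝓝 0)) :
    Tendsto (fun i => eLpNorm (g i) 2 μ) l (𝓝 0) := by
  have h1 := (ENNReal.tendsto_ofReal h)
  simp_rw [fun i => (hg i).ofReal_integral_norm_sq, ENNReal.ofReal_zero] at h1
  have h2 := h1.ennrpow_const (1 / 2 : ℝ)
  have h3 : ∀ c : ℝ≥0∞, (c ^ 2) ^ (1 / 2 : ℝ) = c := fun c => by
    rw [← ENNReal.rpow_two, ← ENNReal.rpow_mul]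
    norm_num
  simpa only [h3, ENNReal.zero_rpow_of_pos (by norm_num : (0 : ℝ) < 1 / 2)] using h2

end SquareIntegrable

namespace IsTestVectorField

variable {N : ℕ} {Ω : Set (EuclideanSpace ℝ (Fin N))}
  {φ : EuclideanSpace ℝ (Fin N) → EuclideanSpace ℝ (Fin N)}

theorem contDiff_one (hφ : IsTestVectorField Ω φ) : ContDiff ℝ 1 φ :=
  hφ.1.of_le (by exact_mod_cast le_top)

theorem eq_zero (hφ : IsTestVectorField Ω φ) {x : EuclideanSpace ℝ (Fin N)} (hx : x ∉ Ω) :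
    φ x = 0 :=
  image_eq_zero_of_notMem_tsupport fun h => hx (hφ.2.2 h)

theorem fderiv_eq_zero (hφ : IsTestVectorField Ω φ) {x : EuclideanSpace ℝ (Fin N)} (hx : x ∉ Ω) :
    fderiv ℝ φ x = 0 :=
  image_eq_zero_of_notMem_tsupport fun h => hx (hφ.2.2 (tsupport_fderiv_subset ℝ h))

theorem memLp (hφ : IsTestVectorField Ω φ) (μ : Measure (EuclideanSpace ℝ (Fin N)))
    [IsFiniteMeasureOnCompacts μ] : MemLp φ 2 μ :=
  hφ.1.continuous.memLp_of_hasCompactSupport hφ.2.1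

theorem memLp_fderiv (hφ : IsTestVectorField Ω φ) (μ : Measure (EuclideanSpace ℝ (Fin N)))
    [IsFiniteMeasureOnCompacts μ] : MemLp (fderiv ℝ φ) 2 μ :=
  (hφ.contDiff_one.continuous_fderiv one_ne_zero).memLp_of_hasCompactSupport (hφ.2.1.fderiv ℝ)

end IsTestVectorField

namespace MemW012

variable {N : ℕ} {Ω : Set (EuclideanSpace ℝ (Fin N))}
  {v : EuclideanSpace ℝ (Fin N) → EuclideanSpace ℝ (Fin N)}
  {Dv : EuclideanSpace ℝ (Fin N) → (EuclideanSpace ℝ (Fin N) →L[ℝ] EuclideanSpace ℝ (Fin N))}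

theorem exists_tendsto_eLpNorm (h : MemW012 Ω v Dv) (hv : MemLp v 2 (volume.restrict Ω))
    (hDv : MemLp Dv 2 (volume.restrict Ω)) :
    ∃ φ : ℕ → EuclideanSpace ℝ (Fin N) → EuclideanSpace ℝ (Fin N),
      (∀ n, IsTestVectorField Ω (φ n)) ∧
      Tendsto (fun n => eLpNorm (φ n - v) 2 (volume.restrict Ω)) atTop (𝓝 0) ∧
      Tendsto (fun n => eLpNorm (fderiv ℝ (φ n) - Dv) 2 (volume.restrict Ω)) atTop (𝓝 0) := by
  obtain ⟨φ, hφ, h1, h2⟩ := h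
  exact ⟨φ, hφ, tendsto_eLpNorm_two_of_tendsto_integral (fun n => ((hφ n).memLp _).sub hv) h1,
    tendsto_eLpNorm_two_of_tendsto_integral (fun n => ((hφ n).memLp_fderiv _).sub hDv) h2⟩

theorem lintegral_translate_sub_sq_le (h : MemW012 Ω v Dv) (hΩ : MeasurableSet Ω)
    (hv : MemLp v 2 (volume.restrict Ω)) (hDv : MemLp Dv 2 (volume.restrict Ω))
    (y : EuclideanSpace ℝ (Fin N)) :
    ∫⁻ x, ‖Ω.indicator v (x + y) - Ω.indicator v x‖ₑ ^ 2
      ≤ ‖y‖ₑ ^ 2 * ∫⁻ x in Ω, ‖Dv x‖ₑ ^ 2 := by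
  obtain ⟨φ, hφ, h1, h2⟩ := h.exists_tendsto_eLpNorm hv hDv
  have hv' : MemLp (Ω.indicator v) 2 volume := (memLp_indicator_iff_restrict hΩ).2 hv
  have hτ := measurePreserving_add_right (volume : Measure (EuclideanSpace ℝ (Fin N))) y
  suffices hmain : eLpNorm (fun x => Ω.indicator v (x + y) - Ω.indicator v x) 2 volume
      ≤ ‖y‖ₑ * eLpNorm Dv 2 (volume.restrict Ω) by
    have := pow_le_pow_left' hmain 2
    rwa [mul_pow, eLpNorm_two_sq_eq_lintegral, eLpNorm_two_sq_eq_lintegral] at this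
  have hbound : ∀ n, eLpNorm (fun x => Ω.indicator v (x + y) - Ω.indicator v x) 2 volume
      ≤ 2 * eLpNorm (φ n - v) 2 (volume.restrict Ω)
        + ‖y‖ₑ * (eLpNorm (fderiv ℝ (φ n) - Dv) 2 (volume.restrict Ω)
          + eLpNorm Dv 2 (volume.restrict Ω)) := by
    intro n
    have hφn := hφ n
    have hd : MemLp (Ω.indicator v - φ n) 2 volume := hv'.sub (hφn.memLp _)
    have hdeq : eLpNorm (Ω.indicator v - φ n) 2 volume
        = eLpNorm (φ n - v) 2 (volume.restrict Ω) := by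
      rw [eLpNorm_sub_comm, ← eLpNorm_indicator_eq_eLpNorm_restrict hΩ]
      congr 1
      ext1 x
      by_cases hx : x ∈ Ω <;> simp [hx, hφn.eq_zero]
    have hdτ : MemLp ((Ω.indicator v - φ n) ∘ fun x => x + y) 2 volume :=
      hd.comp_measurePreserving hτ
    have hφτ : MemLp (fun x => φ n (x + y) - φ n x) 2 volume :=
      ((hφn.memLp volume).comp_measurePreserving hτ).sub (hφn.memLp _)
    have hsplit : (fun x => Ω.indicator v (x + y) - Ω.indicator v x)
        = ((Ω.indicator v - φ n) ∘ fun x => x + y)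
          + (fun x => φ n (x + y) - φ n x) - (Ω.indicator v - φ n) := by
      ext1 x
      simp only [Pi.sub_apply, Pi.add_apply, Function.comp]
      abel
    have hφle : eLpNorm (fun x => φ n (x + y) - φ n x) 2 volume
        ≤ ‖y‖ₑ * eLpNorm (fderiv ℝ (φ n)) 2 (volume.restrict Ω) := by
      rw [eLpNorm_two_eq_lintegral_rpow, eLpNorm_two_eq_lintegral_rpow,
        setLIntegral_eq_of_support_subset]
      · calc _ ≤ (‖y‖ₑ ^ 2 * ∫⁻ x, ‖fderiv ℝ (φ n) x‖ₑ ^ 2) ^ (1 / 2 : ℝ) :=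
            ENNReal.rpow_le_rpow
              (lintegral_enorm_translate_sub_sq_le volume hφn.contDiff_one y) (by norm_num)
          _ = _ := by
            rw [ENNReal.mul_rpow_of_nonneg _ _ (by norm_num), ← ENNReal.rpow_two,
              ← ENNReal.rpow_mul]
            norm_num
      · intro x hx
        by_contra hxΩ
        exact hx (by simp [hφn.fderiv_eq_zero hxΩ])
    have htri : eLpNorm (fderiv ℝ (φ n)) 2 (volume.restrict Ω)
        ≤ eLpNorm (fderiv ℝ (φ n) - Dv) 2 (volume.restrict Ω)
          + eLpNorm Dv 2 (volume.restrict Ω) := by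
      have := eLpNorm_add_le (((hφn.memLp_fderiv (volume.restrict Ω)).sub hDv).1) hDv.1
        (p := 2) (by norm_num)
      rwa [sub_add_cancel] at this
    rw [hsplit]
    refine (eLpNorm_sub_le (hdτ.add hφτ).1 hd.1 (by norm_num)).trans ?_
    refine (add_le_add_left (eLpNorm_add_le hdτ.1 hφτ.1 (by norm_num)) _).trans ?_
    rw [eLpNorm_comp_measurePreserving hd.1 hτ, hdeq, two_mul]
    calc _ ≤ _ := add_le_add_left (add_le_add_right (hφle.trans (mul_le_mul_right htri _)) _) _
      _ = _ := by ring
  have hlim : Tendsto (fun n => 2 * eLpNorm (φ n - v) 2 (volume.restrict Ω)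
        + ‖y‖ₑ * (eLpNorm (fderiv ℝ (φ n) - Dv) 2 (volume.restrict Ω)
          + eLpNorm Dv 2 (volume.restrict Ω))) atTop
      (𝓝 (2 * 0 + ‖y‖ₑ * (0 + eLpNorm Dv 2 (volume.restrict Ω)))) := by
    refine Tendsto.add (ENNReal.Tendsto.const_mul h1 (Or.inr (by norm_num)))
      (ENNReal.Tendsto.const_mul (h2.add tendsto_const_nhds) (Or.inr (by finiteness)))
  simpa using ge_of_tendsto' hlim hbound

end MemW012

theorem integral_fderiv_eq_zero_of_hasCompactSupport {E : Type*} [NormedAddCommGroup E]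
    [NormedSpace ℝ E] [FiniteDimensional ℝ E] [MeasurableSpace E] [BorelSpace E] (μ : Measure E)
    [μ.IsAddHaarMeasure] {b : E → ℝ} (hb : ContDiff ℝ 1 b) (hbs : HasCompactSupport b) :
    ∫ z, fderiv ℝ b z ∂μ = 0 := by
  have hint : Integrable (fderiv ℝ b) μ :=
    (hb.continuous_fderiv one_ne_zero).integrable_of_hasCompactSupport (hbs.fderiv ℝ)
  ext v
  have h := integral_mul_fderiv_eq_neg_fderiv_mul_of_integrable (μ := μ) (f := fun _ : E => (1 : ℝ))
    (g := b) (v := v) (by simp) (by simpa using hint.apply_continuousLinearMap v)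
    (by simpa using hb.continuous.integrable_of_hasCompactSupport hbs)
    (fun x _ => differentiableAt_const _) (fun x _ => hb.differentiable one_ne_zero x)
  rw [ContinuousLinearMap.integral_apply hint]
  simpa using h

section Mollify

open scoped Convolution

variable {E : Type*} [NormedAddCommGroup E] [InnerProductSpace ℝ E] [FiniteDimensional ℝ E]
  [MeasurableSpace E] [BorelSpace E]

theorem lintegral_sq_lintegral_kernel_le (μ : Measure E) [SFinite μ] {Ω : Set E}
    {P χ : E → ℝ} (hP : Measurable P)
    (hχ : Measurable χ) {A : ℝ≥0∞}
    (hA : ∀ h : E, ∫⁻ x in Ω, ‖P x * (χ (x + h) - χ x)‖ₑ ^ 2 ∂μ ≤ A * ‖h‖ₑ ^ 2)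
    {k : E → ℝ≥0∞} (hk : Measurable k) {R : ℝ} (hR : ∀ z, k z ≠ 0 → ‖z‖ ≤ R) (ε : ℝ) :
    ∫⁻ x in Ω, (∫⁻ z, k z * ‖P x * (χ (x - ε • z) - χ x)‖ₑ ∂μ) ^ 2 ∂μ
      ≤ (∫⁻ z, k z ∂μ) ^ 2 * (A * ENNReal.ofReal (|ε| * R) ^ 2) := by
  have hm : Measurable fun p : E × E => k p.2 * ‖P p.1 * (χ (p.1 - ε • p.2) - χ p.1)‖ₑ ^ 2 := by
    fun_prop
  calc ∫⁻ x in Ω, (∫⁻ z, k z * ‖P x * (χ (x - ε • z) - χ x)‖ₑ ∂μ) ^ 2 ∂μ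
      ≤ ∫⁻ x in Ω, (∫⁻ z, k z ∂μ) *
          ∫⁻ z, k z * ‖P x * (χ (x - ε • z) - χ x)‖ₑ ^ 2 ∂μ ∂μ := by
        refine lintegral_mono fun x => ENNReal.sq_lintegral_weighted_le _ hk.aemeasurable ?_
        exact Measurable.aemeasurable (by fun_prop)
    _ = (∫⁻ z, k z ∂μ) * ∫⁻ z, (∫⁻ x in Ω, k z * ‖P x * (χ (x - ε • z) - χ x)‖ₑ ^ 2 ∂μ) ∂μ := by
        rw [lintegral_const_mul _ (Measurable.lintegral_prod_right hm),
          lintegral_lintegral_swap hm.aemeasurable]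
    _ ≤ (∫⁻ z, k z ∂μ) * ∫⁻ z, k z * (A * ENNReal.ofReal (|ε| * R) ^ 2) ∂μ := by
        gcongr with z
        rw [lintegral_const_mul _ (by fun_prop)]
        by_cases hz : k z = 0
        · simp [hz]
        gcongr
        have h1 := hA (-(ε • z))
        simp only [← sub_eq_add_neg] at h1
        refine h1.trans ?_
        gcongr
        rw [enorm_neg, ← ofReal_norm, norm_smul, Real.norm_eq_abs]
        gcongr
        exact hR z hz
    _ = _ := by rw [lintegral_mul_const _ hk]; ring

theorem exists_mollified_cutoff (μ : Measure E) [μ.IsAddHaarMeasure] :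
    ∃ C : ℝ≥0∞, C ≠ ⊤ ∧ ∀ (Ω K : Set E), IsOpen Ω → IsCompact K → K ⊆ Ω →
      ∀ P χ : E → ℝ, Measurable P → Measurable χ → (∀ x, χ x ∈ Set.Icc (0 : ℝ) 1) →
      (∀ x ∉ K, χ x = 0) → ∀ A : ℝ≥0∞, A ≠ ⊤ →
      (∀ h : E, ∫⁻ x in Ω, ‖P x * (χ (x + h) - χ x)‖ₑ ^ 2 ∂μ ≤ A * ‖h‖ₑ ^ 2) →
      ∀ η : ℝ≥0∞, η ≠ 0 → ∃ θ : E → ℝ, ContDiff ℝ (⊤ : ℕ∞) θ ∧ HasCompactSupport θ ∧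
        tsupport θ ⊆ Ω ∧ (∀ x, θ x ∈ Set.Icc (0 : ℝ) 1) ∧
        ∫⁻ x in Ω, ‖P x‖ₑ ^ 2 * ‖fderiv ℝ θ x‖ₑ ^ 2 ∂μ ≤ C * A ∧
        ∫⁻ x in Ω, ‖P x‖ₑ ^ 2 * ‖θ x - χ x‖ₑ ^ 2 ∂μ ≤ η := by
  let B : ContDiffBump (0 : E) := ⟨1, 2, one_pos, one_lt_two⟩
  set b : E → ℝ := B.normed μ with hb
  have hbc : ContDiff ℝ (⊤ : ℕ∞) b := B.contDiff_normed
  have hbc1 : ContDiff ℝ 1 b := hbc.of_le (by exact_mod_cast le_top)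
  have hbs : HasCompactSupport b := B.hasCompactSupport_normed
  have hb0 : ∀ z, 0 ≤ b z := B.nonneg_normed
  have hb1 : ∫ z, b z ∂μ = 1 := B.integral_normed
  have hbi : Integrable b μ := hbc.continuous.integrable_of_hasCompactSupport hbs
  have hbts : tsupport b = Metric.closedBall 0 2 := B.tsupport_normed_eq
  have hDc : Continuous (fderiv ℝ b) := hbc1.continuous_fderiv one_ne_zero
  have hDi : Integrable (fderiv ℝ b) μ := hDc.integrable_of_hasCompactSupport (hbs.fderiv ℝ)
  have hbR : ∀ z, ‖b z‖ₑ ≠ 0 → ‖z‖ ≤ 2 := fun z hz => by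
    have : z ∈ tsupport b := subset_tsupport _ (by simpa using hz)
    simpa [hbts] using this
  have hDR : ∀ z, ‖fderiv ℝ b z‖ₑ ≠ 0 → ‖z‖ ≤ 2 := fun z hz => by
    have : z ∈ tsupport b := tsupport_fderiv_subset ℝ (subset_tsupport (fderiv ℝ b) fun h =>
      hz (by rw [h, ← ofReal_norm, norm_zero, ENNReal.ofReal_zero]))
    simpa [hbts] using this
  refine ⟨(∫⁻ z, ‖fderiv ℝ b z‖ₑ ∂μ) ^ 2 * 4, ?_, ?_⟩
  · have : ∫⁻ z, ‖fderiv ℝ b z‖ₑ ∂μ ≠ ⊤ := hDi.2.ne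
    finiteness
  intro Ω K hΩ hK hKΩ P χ hP hχ hχ01 hχK A hA hbound η hη
  obtain ⟨δ, hδ, hδΩ⟩ := hK.exists_cthickening_subset_open hΩ hKΩ
  obtain ⟨ε, hε, hεδ, hεη⟩ : ∃ ε : ℝ, 0 < ε ∧ ε * 2 ≤ δ ∧
      A * ENNReal.ofReal (|ε| * 2) ^ 2 ≤ η := by
    have h1 : Tendsto (fun ε : ℝ => A * ENNReal.ofReal (|ε| * 2) ^ 2) (𝓝[>] 0) (𝓝 0) := by
      have h2 : Tendsto (fun ε : ℝ => ENNReal.ofReal (|ε| * 2)) (𝓝[>] 0) (𝓝 0) := by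
        have : Continuous fun ε : ℝ => ENNReal.ofReal (|ε| * 2) :=
          ENNReal.continuous_ofReal.comp (by fun_prop)
        simpa using (this.tendsto 0).mono_left nhdsWithin_le_nhds
      simpa using ENNReal.Tendsto.const_mul (ENNReal.Tendsto.pow (n := 2) h2) (Or.inr hA)
    have h3 : ∀ᶠ ε : ℝ in 𝓝[>] 0, ε < δ / 2 :=
      (gt_mem_nhds (by positivity)).filter_mono nhdsWithin_le_nhds
    obtain ⟨ε, ha, hb, hc⟩ := ((h1.eventually (gt_mem_nhds (pos_iff_ne_zero.2 hη))).and
      (h3.and self_mem_nhdsWithin)).exists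
    exact ⟨ε, hc, by linarith, ha.le⟩
  set X : E → ℝ := fun y => χ (ε • y) with hX
  have hXm : Measurable X := by fun_prop
  have hXl : LocallyIntegrable X μ := by
    refine (locallyIntegrable_const (1 : ℝ)).mono hXm.aestronglyMeasurable
      (Eventually.of_forall fun y => ?_)
    rw [Real.norm_eq_abs, abs_of_nonneg (hχ01 _).1]
    simpa using (hχ01 (ε • y)).2
  let L := ContinuousLinearMap.lsmul ℝ ℝ (E := ℝ)
  let θ : E → ℝ := fun x => (b ⋆[L, μ] X) (ε⁻¹ • x)
  have hXe : ∀ x z, X (ε⁻¹ • x - z) = χ (x - ε • z) := fun x z => by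
    simp [hX, smul_sub, smul_smul, hε.ne']
  have hθ : ∀ x, θ x = ∫ z, b z * χ (x - ε • z) ∂μ := fun x => by
    simp only [θ, convolution_def, hXe, L, ContinuousLinearMap.lsmul_apply, smul_eq_mul]
  have hχm : ∀ x, Measurable fun z => χ (x - ε • z) := fun x => by fun_prop
  have hχn : ∀ x, ‖χ x‖ ≤ 1 := fun x => by
    rw [Real.norm_eq_abs, abs_of_nonneg (hχ01 _).1]; exact (hχ01 x).2
  have hbχ : ∀ x, Integrable (fun z => b z * χ (x - ε • z)) μ := fun x =>
    hbi.mul_bdd (hχm x).aestronglyMeasurable (Eventually.of_forall fun z => hχn _)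
  have hDθ : ∀ x, fderiv ℝ θ x = ε⁻¹ • ∫ z, (χ (x - ε • z) - χ x) • fderiv ℝ b z ∂μ := by
    intro x
    have h1 := hbs.hasFDerivAt_convolution_left L hbc1 hXl (ε⁻¹ • x)
    have h2 : HasFDerivAt (fun x : E => ε⁻¹ • x) (ε⁻¹ • ContinuousLinearMap.id ℝ E) x :=
      (hasFDerivAt_id x).const_smul ε⁻¹
    have h3 : HasFDerivAt θ _ x := HasFDerivAt.comp (g := b ⋆[L, μ] X) x h1 h2
    have h4 : (fderiv ℝ b ⋆[L.precompL E, μ] X) (ε⁻¹ • x)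
        = ∫ z, χ (x - ε • z) • fderiv ℝ b z ∂μ := by
      rw [convolution_def]
      congr 1
      ext1 z
      ext v
      simp [hXe, L, mul_comm, ContinuousLinearMap.precompL_apply]
    have hi : Integrable (fun z => χ (x - ε • z) • fderiv ℝ b z) μ :=
      hDi.bdd_smul 1 (hχm x).aestronglyMeasurable (Eventually.of_forall fun z => hχn _)
    rw [h3.fderiv, h4]
    have hi' : Integrable (fun z => χ x • fderiv ℝ b z) μ := hDi.smul (χ x)
    simp_rw [sub_smul]
    rw [integral_sub hi hi', integral_smul,
      integral_fderiv_eq_zero_of_hasCompactSupport μ hbc1 hbs]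
    ext v
    simp
  have hθ0 : ∀ x ∉ Metric.cthickening (ε * 2) K, θ x = 0 := by
    intro x hx
    rw [hθ]
    refine integral_eq_zero_of_ae (Eventually.of_forall fun z => ?_)
    by_contra hz
    obtain ⟨hz1, hz2⟩ := mul_ne_zero_iff.1 hz
    apply hx
    have hzK : x - ε • z ∈ K := by
      by_contra h
      exact hz2 (hχK _ h)
    refine Metric.mem_cthickening_of_dist_le _ _ _ _ hzK ?_
    rw [dist_eq_norm, sub_sub_cancel, norm_smul, Real.norm_of_nonneg hε.le]
    gcongr
    exact hbR z (by simpa using hz1)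
  have hts : tsupport θ ⊆ Metric.cthickening (ε * 2) K :=
    closure_minimal (fun x hx => by_contra fun h => hx (hθ0 x h)) Metric.isClosed_cthickening
  refine ⟨θ, ?_, ?_, ?_, ?_, ?_, ?_⟩
  · exact (hbs.contDiff_convolution_left L hbc hXl).comp (contDiff_const_smul _)
  · exact HasCompactSupport.intro hK.cthickening hθ0
  · exact hts.trans ((Metric.cthickening_mono hεδ K).trans hδΩ)
  · intro x
    rw [hθ]
    refine ⟨integral_nonneg fun z => mul_nonneg (hb0 z) (hχ01 _).1, ?_⟩
    rw [← hb1]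
    exact integral_mono (hbχ x) hbi fun z => mul_le_of_le_one_right (hb0 z) (hχ01 _).2
  · have h1 := lintegral_sq_lintegral_kernel_le μ hP hχ hbound
      (k := fun z => ‖fderiv ℝ b z‖ₑ) hDc.enorm.measurable hDR ε
    calc ∫⁻ x in Ω, ‖P x‖ₑ ^ 2 * ‖fderiv ℝ θ x‖ₑ ^ 2 ∂μ
        ≤ ∫⁻ x in Ω, ‖ε⁻¹‖ₑ ^ 2 *
            (∫⁻ z, ‖fderiv ℝ b z‖ₑ * ‖P x * (χ (x - ε • z) - χ x)‖ₑ ∂μ) ^ 2 ∂μ := by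
          refine lintegral_mono fun x => ?_
          rw [← mul_pow, ← mul_pow, hDθ, enorm_smul, mul_left_comm]
          gcongr
          calc _ ≤ ‖P x‖ₑ * ∫⁻ z, ‖(χ (x - ε • z) - χ x) • fderiv ℝ b z‖ₑ ∂μ := by
                gcongr
                exact enorm_integral_le_lintegral_enorm _
            _ = _ := by
                rw [← lintegral_const_mul' _ _ (by finiteness)]
                simp_rw [enorm_smul, enorm_mul]
                congr 1
                ext1 z
                ring
      _ = ‖ε⁻¹‖ₑ ^ 2 * ∫⁻ x in Ω,
            (∫⁻ z, ‖fderiv ℝ b z‖ₑ * ‖P x * (χ (x - ε • z) - χ x)‖ₑ ∂μ) ^ 2 ∂μ :=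
          lintegral_const_mul' _ _ (by finiteness)
      _ ≤ ‖ε⁻¹‖ₑ ^ 2 * ((∫⁻ z, ‖fderiv ℝ b z‖ₑ ∂μ) ^ 2 *
            (A * ENNReal.ofReal (|ε| * 2) ^ 2)) := by gcongr
      _ = _ := by
          have h5 : ‖ε⁻¹‖ₑ ^ 2 * ENNReal.ofReal (|ε| * 2) ^ 2 = 4 := by
            rw [← ofReal_norm, ← mul_pow, ← ENNReal.ofReal_mul (norm_nonneg _), norm_inv,
              Real.norm_eq_abs, inv_mul_cancel_left₀ (abs_pos.2 hε.ne').ne']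
            norm_num
          rw [← h5]
          ring
  · have h1 := lintegral_sq_lintegral_kernel_le μ hP hχ hbound
      (k := fun z => ‖b z‖ₑ) hbc.continuous.enorm.measurable hbR ε
    have h2 : ∫⁻ z, ‖b z‖ₑ ∂μ = 1 := by
      have := ofReal_integral_eq_lintegral_ofReal hbi (Eventually.of_forall hb0)
      rw [hb1, ENNReal.ofReal_one] at this
      rw [this]
      congr 1
      ext1 z
      rw [← ofReal_norm, Real.norm_of_nonneg (hb0 z)]
    rw [h2, one_pow, one_mul] at h1
    refine le_trans (lintegral_mono fun x => ?_) (h1.trans hεη)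
    rw [← mul_pow]
    gcongr
    have h3 : θ x - χ x = ∫ z, b z * (χ (x - ε • z) - χ x) ∂μ := by
      simp_rw [mul_sub]
      rw [integral_sub (hbχ x) (hbi.mul_const _), integral_mul_const, hb1, hθ, one_mul]
    rw [h3]
    calc _ ≤ ‖P x‖ₑ * ∫⁻ z, ‖b z * (χ (x - ε • z) - χ x)‖ₑ ∂μ := by
          gcongr
          exact enorm_integral_le_lintegral_enorm _
      _ = _ := by
          rw [← lintegral_const_mul' _ _ (by finiteness)]
          simp_rw [enorm_mul]
          congr 1
          ext1 z
          ring

end Mollify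

/-- The trace of an endomorphism of `ℝᴺ`, as a continuous linear functional. -/
noncomputable def euclideanTrace (N : ℕ) :
    (EuclideanSpace ℝ (Fin N) →L[ℝ] EuclideanSpace ℝ (Fin N)) →L[ℝ] ℝ :=
  ∑ i, (EuclideanSpace.proj i).comp
    (ContinuousLinearMap.apply ℝ (EuclideanSpace ℝ (Fin N)) (EuclideanSpace.single i 1))

theorem euclideanTrace_apply {N : ℕ}
    (L : EuclideanSpace ℝ (Fin N) →L[ℝ] EuclideanSpace ℝ (Fin N)) :
    euclideanTrace N L = ∑ i, L (EuclideanSpace.single i 1) i := by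
  simp [euclideanTrace]

theorem integral_fderiv_apply_add_mul_euclideanTrace {N : ℕ}
    {φ : EuclideanSpace ℝ (Fin N) → EuclideanSpace ℝ (Fin N)} (hφ : ContDiff ℝ 1 φ)
    {q : EuclideanSpace ℝ (Fin N) → ℝ} (hq : ContDiff ℝ 1 q) (hqs : HasCompactSupport q) :
    ∫ x, (fderiv ℝ q x (φ x) + q x * euclideanTrace N (fderiv ℝ φ x)) = 0 := by
  have hqc := hq.continuous_fderiv one_ne_zero
  have hφc := hφ.continuous_fderiv one_ne_zero
  have hdi : ∀ i x, fderiv ℝ (fun x => φ x i) x (EuclideanSpace.single i 1)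
      = fderiv ℝ φ x (EuclideanSpace.single i 1) i := fun i x => by
    have : HasFDerivAt (fun x => φ x i) ((EuclideanSpace.proj i).comp (fderiv ℝ φ x)) x :=
      (EuclideanSpace.proj (𝕜 := ℝ) i).hasFDerivAt.comp x
        (hφ.differentiable one_ne_zero x).hasFDerivAt
    rw [this.fderiv]
    rfl
  have hφi : ∀ i, Continuous fun x => φ x i := fun i => by fun_prop
  have hsum : ∀ x, fderiv ℝ q x (φ x) + q x * euclideanTrace N (fderiv ℝ φ x)
      = ∑ i, (fderiv ℝ q x (EuclideanSpace.single i 1) * φ x i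
        + q x * fderiv ℝ φ x (EuclideanSpace.single i 1) i) := fun x => by
    rw [euclideanTrace_apply, Finset.sum_add_distrib, Finset.mul_sum]
    congr 1
    conv_lhs => rw [← (EuclideanSpace.basisFun (Fin N) ℝ).sum_repr (φ x)]
    simp [mul_comm]
  have hqd : HasCompactSupport (fderiv ℝ q) := hqs.fderiv ℝ
  have h1 : ∀ i : Fin N, Integrable fun x =>
      fderiv ℝ q x (EuclideanSpace.single i 1) * φ x i := fun i => by
    refine Continuous.integrable_of_hasCompactSupport (by fun_prop) ?_
    exact hqd.mono' ((Function.support_subset_iff'.2 fun x hx => by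
      rw [image_eq_zero_of_notMem_tsupport hx]; simp))
  have h2 : ∀ i : Fin N, Integrable fun x =>
      q x * fderiv ℝ φ x (EuclideanSpace.single i 1) i := fun i => by
    refine Continuous.integrable_of_hasCompactSupport (by fun_prop) ?_
    exact hqs.mul_right
  have h3 : ∀ i : Fin N, Integrable fun x => q x * φ x i := fun i =>
    Continuous.integrable_of_hasCompactSupport (by fun_prop) hqs.mul_right
  simp_rw [hsum]
  rw [integral_finsetSum (f := fun i x => fderiv ℝ q x (EuclideanSpace.single i 1) * φ x i
    + q x * fderiv ℝ φ x (EuclideanSpace.single i 1) i) _ fun i _ => (h1 i).add (h2 i)]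
  refine Finset.sum_eq_zero fun i _ => ?_
  rw [integral_add (h1 i) (h2 i)]
  have h := integral_mul_fderiv_eq_neg_fderiv_mul_of_integrable (μ := volume) (f := q)
    (g := fun x => φ x i) (v := EuclideanSpace.single i 1) (h1 i)
    (by simpa only [hdi] using h2 i) (h3 i)
    (fun x _ => hq.differentiable one_ne_zero x)
    (fun x _ => (EuclideanSpace.proj (𝕜 := ℝ) i).differentiableAt.comp x
      (hφ.differentiable one_ne_zero x))
  simp_rw [hdi] at h
  rw [h]
  ring

namespace MemW012

variable {N : ℕ} {Ω : Set (EuclideanSpace ℝ (Fin N))}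
  {v : EuclideanSpace ℝ (Fin N) → EuclideanSpace ℝ (Fin N)}
  {Dv : EuclideanSpace ℝ (Fin N) → (EuclideanSpace ℝ (Fin N) →L[ℝ] EuclideanSpace ℝ (Fin N))}

theorem setIntegral_fderiv_apply_add_mul_euclideanTrace (h : MemW012 Ω v Dv)
    [IsFiniteMeasure (volume.restrict Ω)]
    (hv : MemLp v 2 (volume.restrict Ω)) (hDv : MemLp Dv 2 (volume.restrict Ω))
    {q : EuclideanSpace ℝ (Fin N) → ℝ} (hq : ContDiff ℝ 1 q) (hqs : HasCompactSupport q) :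
    ∫ x in Ω, (fderiv ℝ q x (v x) + q x * euclideanTrace N (Dv x)) = 0 := by
  obtain ⟨φ, hφ, h1, h2⟩ := h.exists_tendsto_eLpNorm hv hDv
  have hqc := hq.continuous_fderiv one_ne_zero
  obtain ⟨c, hc⟩ := hqc.bounded_above_of_compact_support (hqs.fderiv ℝ)
  obtain ⟨d, hd⟩ := hq.continuous.bounded_above_of_compact_support hqs
  have hmeas : ∀ (w : EuclideanSpace ℝ (Fin N) → EuclideanSpace ℝ (Fin N)) (Dw : _),
      AEStronglyMeasurable w (volume.restrict Ω) → AEStronglyMeasurable Dw (volume.restrict Ω) →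
      AEStronglyMeasurable (fun x => fderiv ℝ q x (w x) + q x * euclideanTrace N (Dw x))
        (volume.restrict Ω) := fun w Dw hw hDw =>
    (isBoundedBilinearMap_apply.continuous.comp_aestronglyMeasurable
      (hqc.aestronglyMeasurable.prodMk hw)).add (hq.continuous.aestronglyMeasurable.mul
      ((euclideanTrace N).continuous.comp_aestronglyMeasurable hDw))
  have hz : ∀ n, ∫ x in Ω, (fderiv ℝ q x (φ n x)
      + q x * euclideanTrace N (fderiv ℝ (φ n) x)) = 0 := fun n => by
    rw [setIntegral_eq_integral_of_forall_compl_eq_zero fun x hx => by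
      simp [(hφ n).eq_zero hx, (hφ n).fderiv_eq_zero hx]]
    exact integral_fderiv_apply_add_mul_euclideanTrace (hφ n).contDiff_one hq hqs
  refine tendsto_nhds_unique (tendsto_integral_of_L1 _ (hmeas v Dv hv.1 hDv.1)
    (F := fun n x => fderiv ℝ q x (φ n x) + q x * euclideanTrace N (fderiv ℝ (φ n) x))
    (l := atTop) (Eventually.of_forall fun n => ?_) ?_) (by simp [hz])
  · refine Continuous.integrable_of_hasCompactSupport ?_ ?_ |>.integrableOn
    · have := (hφ n).1.continuous
      have := (hφ n).contDiff_one.continuous_fderiv one_ne_zero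
      fun_prop
    · refine (hφ n).2.1.mono' ((Function.support_subset_iff'.2 fun x hx => ?_))
      rw [image_eq_zero_of_notMem_tsupport hx, image_eq_zero_of_notMem_tsupport
        fun h => hx (tsupport_fderiv_subset ℝ h)]
      simp
  · have hfin : volume Ω < ⊤ := by simpa using measure_lt_top (volume.restrict Ω) Set.univ
    have hL1 : ∀ {F : Type} [NormedAddCommGroup F] (g : ℕ → EuclideanSpace ℝ (Fin N) → F),
        (∀ n, AEStronglyMeasurable (g n) (volume.restrict Ω)) →
        Tendsto (fun n => eLpNorm (g n) 2 (volume.restrict Ω)) atTop (𝓝 0) →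
        Tendsto (fun n => ∫⁻ x in Ω, ‖g n x‖ₑ) atTop (𝓝 0) := fun g hg hlim => by
      refine tendsto_of_tendsto_of_tendsto_of_le_of_le tendsto_const_nhds
        (h := fun n => eLpNorm (g n) 2 (volume.restrict Ω)
          * volume.restrict Ω Set.univ ^ (1 / 2 : ℝ)) ?_ (fun _ => zero_le) fun n => ?_
      · simpa using ENNReal.Tendsto.mul_const hlim
          (Or.inr (ENNReal.rpow_ne_top_of_nonneg (by norm_num) hfin.ne))
      · have := eLpNorm_le_eLpNorm_mul_rpow_measure_univ (p := 1) (q := 2) (by norm_num) (hg n)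
        norm_num [eLpNorm_one_eq_lintegral_enorm] at this ⊢
        exact this
    have hlim : Tendsto (fun n => ENNReal.ofReal c * (∫⁻ x in Ω, ‖(φ n - v) x‖ₑ)
        + ENNReal.ofReal d * (‖euclideanTrace N‖ₑ * ∫⁻ x in Ω, ‖(fderiv ℝ (φ n) - Dv) x‖ₑ))
        atTop (𝓝 (ENNReal.ofReal c * 0 + ENNReal.ofReal d * (‖euclideanTrace N‖ₑ * 0))) := by
      refine Tendsto.add (ENNReal.Tendsto.const_mul (hL1 _ ?_ h1) (Or.inr (by finiteness)))
        (ENNReal.Tendsto.const_mul (ENNReal.Tendsto.const_mul (hL1 _ ?_ h2)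
          (Or.inr (by finiteness))) (Or.inr (by finiteness)))
      · exact fun n => (((hφ n).memLp _).sub hv).1
      · exact fun n => (((hφ n).memLp_fderiv _).sub hDv).1
    simp only [mul_zero, add_zero] at hlim
    refine tendsto_of_tendsto_of_tendsto_of_le_of_le tendsto_const_nhds hlim
      (fun _ => zero_le) fun n => ?_
    rw [← lintegral_const_mul' _ _ (by finiteness), ← lintegral_const_mul' _ _ (by finiteness),
      ← lintegral_const_mul' _ _ (by finiteness), ← lintegral_add_left']
    · refine lintegral_mono fun x => ?_
      have : fderiv ℝ q x (φ n x) + q x * euclideanTrace N (fderiv ℝ (φ n) x)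
          - (fderiv ℝ q x (v x) + q x * euclideanTrace N (Dv x))
          = fderiv ℝ q x ((φ n - v) x) + q x * euclideanTrace N ((fderiv ℝ (φ n) - Dv) x) := by
        simp only [Pi.sub_apply, map_sub]
        ring
      rw [this]
      refine (enorm_add_le _ _).trans (add_le_add ?_ ?_)
      · refine ((fderiv ℝ q x).le_opENorm _).trans ?_
        gcongr
        rw [← ofReal_norm]
        exact ENNReal.ofReal_le_ofReal (hc x)
      · rw [enorm_mul]
        gcongr
        · rw [← ofReal_norm]
          exact ENNReal.ofReal_le_ofReal (hd x)
        · exact (euclideanTrace N).le_opENorm _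
    · exact ((((hφ n).memLp _).sub hv).1.enorm.const_mul _)

end MemW012

/-- The squared `W^{1,2}(Ω)` energy of a pair consisting of a field and its derivative. -/
noncomputable def sobolevEnergy {N : ℕ} (Ω : Set (EuclideanSpace ℝ (Fin N)))
    (v : EuclideanSpace ℝ (Fin N) → EuclideanSpace ℝ (Fin N))
    (Dv : EuclideanSpace ℝ (Fin N) →
      (EuclideanSpace ℝ (Fin N) →L[ℝ] EuclideanSpace ℝ (Fin N))) : ℝ≥0∞ :=
  ∫⁻ x in Ω, (‖v x‖ₑ ^ 2 + ‖Dv x‖ₑ ^ 2)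

section SobolevEnergy

variable {N : ℕ} {Ω : Set (EuclideanSpace ℝ (Fin N))}

theorem sobolevEnergy_eq {v : EuclideanSpace ℝ (Fin N) → EuclideanSpace ℝ (Fin N)}
    {Dv : EuclideanSpace ℝ (Fin N) → (EuclideanSpace ℝ (Fin N) →L[ℝ] EuclideanSpace ℝ (Fin N))}
    (hv : AEStronglyMeasurable v (volume.restrict Ω)) :
    sobolevEnergy Ω v Dv
      = eLpNorm v 2 (volume.restrict Ω) ^ 2 + eLpNorm Dv 2 (volume.restrict Ω) ^ 2 := by
  rw [sobolevEnergy, lintegral_add_left' (hv.enorm.pow_const 2), eLpNorm_two_sq_eq_lintegral,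
    eLpNorm_two_sq_eq_lintegral]

theorem exists_seq_dense_testVectorField (Ω : Set (EuclideanSpace ℝ (Fin N))) :
    ∃ φ : ℕ → EuclideanSpace ℝ (Fin N) → EuclideanSpace ℝ (Fin N),
      (∀ k, IsTestVectorField Ω (φ k)) ∧
      ∀ ψ, IsTestVectorField Ω ψ → ∀ ε : ℝ≥0∞, ε ≠ 0 →
        ∃ k, sobolevEnergy Ω (ψ - φ k) (fderiv ℝ ψ - fderiv ℝ (φ k)) ≤ ε := by
  let S := {φ : EuclideanSpace ℝ (Fin N) → EuclideanSpace ℝ (Fin N) // IsTestVectorField Ω φ}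
  let G : S → Lp (EuclideanSpace ℝ (Fin N)) 2 (volume.restrict Ω) ×
      Lp (EuclideanSpace ℝ (Fin N) →L[ℝ] EuclideanSpace ℝ (Fin N)) 2 (volume.restrict Ω) :=
    fun φ => ((φ.2.memLp _).toLp φ.1, (φ.2.memLp_fderiv _).toLp (fderiv ℝ φ.1))
  have : Nonempty S := ⟨⟨0, contDiff_const, HasCompactSupport.zero, by simp [tsupport]⟩⟩
  have : Fact ((2 : ℝ≥0∞) ≠ ⊤) := ⟨by norm_num⟩
  have h1 : SecondCountableTopology
      (Lp (EuclideanSpace ℝ (Fin N)) 2 (volume.restrict Ω)) := Lp.SecondCountableTopology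
  have h2 : SecondCountableTopology
      (Lp (EuclideanSpace ℝ (Fin N) →L[ℝ] EuclideanSpace ℝ (Fin N)) 2 (volume.restrict Ω)) :=
    Lp.SecondCountableTopology
  have h3 : SecondCountableTopology (Set.range G) := inferInstance
  obtain ⟨s, hs⟩ := TopologicalSpace.exists_dense_seq (Set.range G)
  choose φ hφ using fun k => (s k).2
  refine ⟨fun k => (φ k).1, fun k => (φ k).2, fun ψ hψ ε hε => ?_⟩
  obtain ⟨δ, hδ0, hδ⟩ : ∃ δ : ℝ≥0∞, 0 < δ ∧ δ ^ 2 + δ ^ 2 ≤ ε := by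
    have h : Tendsto (fun δ : ℝ≥0∞ => δ ^ 2 + δ ^ 2) (𝓝[>] 0) (𝓝 0) := by
      have h2 := ENNReal.Tendsto.pow (n := 2) (tendsto_nhdsWithin_of_tendsto_nhds
        (tendsto_id (α := ℝ≥0∞) (x := 𝓝 0)) (s := Set.Ioi 0))
      simpa using h2.add h2
    obtain ⟨δ, h1, h2⟩ := ((h.eventually (gt_mem_nhds (pos_iff_ne_zero.2 hε))).and
      self_mem_nhdsWithin).exists
    exact ⟨δ, h2, h1.le⟩
  obtain ⟨k, hk⟩ := hs.exists_mem_open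
    (Metric.isOpen_eball (x := ⟨G ⟨ψ, hψ⟩, Set.mem_range_self _⟩) (ε := δ))
    ⟨_, Metric.mem_eball_self hδ0⟩
  refine ⟨k, ?_⟩
  rw [Metric.mem_eball', Subtype.edist_eq, ← hφ k, Prod.edist_eq, max_lt_iff, Lp.edist_toLp_toLp,
    Lp.edist_toLp_toLp] at hk
  rw [sobolevEnergy_eq ((hψ.memLp _).sub ((φ k).2.memLp _)).1]
  exact le_trans (add_le_add (pow_le_pow_left' hk.1.le 2) (pow_le_pow_left' hk.2.le 2)) hδ

theorem MemW012.exists_sobolevEnergy_sub_le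
    {v : EuclideanSpace ℝ (Fin N) → EuclideanSpace ℝ (Fin N)}
    {Dv : EuclideanSpace ℝ (Fin N) → (EuclideanSpace ℝ (Fin N) →L[ℝ] EuclideanSpace ℝ (Fin N))}
    (h : MemW012 Ω v Dv) (hv : MemLp v 2 (volume.restrict Ω))
    (hDv : MemLp Dv 2 (volume.restrict Ω))
    {φ : ℕ → EuclideanSpace ℝ (Fin N) → EuclideanSpace ℝ (Fin N)}
    (hdense : ∀ ψ, IsTestVectorField Ω ψ → ∀ ε : ℝ≥0∞, ε ≠ 0 →
        ∃ k, sobolevEnergy Ω (ψ - φ k) (fderiv ℝ ψ - fderiv ℝ (φ k)) ≤ ε)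
    {ε : ℝ≥0∞} (hε : ε ≠ 0) :
    ∃ k, sobolevEnergy Ω (v - φ k) (Dv - fderiv ℝ (φ k)) ≤ ε := by
  obtain ⟨ψ, hψ, h1, h2⟩ := h.exists_tendsto_eLpNorm hv hDv
  have hlim : Tendsto (fun n => eLpNorm (ψ n - v) 2 (volume.restrict Ω) ^ 2
      + eLpNorm (fderiv ℝ (ψ n) - Dv) 2 (volume.restrict Ω) ^ 2) atTop (𝓝 0) := by
    simpa using (ENNReal.Tendsto.pow (n := 2) h1).add (ENNReal.Tendsto.pow (n := 2) h2)
  have hε4 : ε / 4 ≠ 0 := by simp [hε]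
  obtain ⟨n, hn⟩ := (hlim.eventually (gt_mem_nhds (pos_iff_ne_zero.2 hε4))).exists
  obtain ⟨k, hk⟩ := hdense (ψ n) (hψ n) _ hε4
  refine ⟨k, ?_⟩
  have hsq : ∀ {F : Type} [NormedAddCommGroup F] (a b c : F),
      ‖a - c‖ₑ ^ 2 ≤ 2 * (‖b - a‖ₑ ^ 2 + ‖b - c‖ₑ ^ 2) := fun a b c => by
    refine le_trans (pow_le_pow_left' ?_ 2) (ENNReal.add_sq_le_two_mul _ _)
    rw [← edist_eq_enorm_sub, ← edist_eq_enorm_sub, ← edist_eq_enorm_sub, edist_comm b a]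
    exact edist_triangle _ _ _
  have hm : AEMeasurable (fun x => ‖(ψ n - v) x‖ₑ ^ 2 + ‖(fderiv ℝ (ψ n) - Dv) x‖ₑ ^ 2)
      (volume.restrict Ω) :=
    ((((hψ n).memLp _).sub hv).1.enorm.pow_const 2).add
      ((((hψ n).memLp_fderiv _).sub hDv).1.enorm.pow_const 2)
  calc sobolevEnergy Ω (v - φ k) (Dv - fderiv ℝ (φ k))
      ≤ ∫⁻ x in Ω, 2 * ((‖(ψ n - v) x‖ₑ ^ 2 + ‖(fderiv ℝ (ψ n) - Dv) x‖ₑ ^ 2)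
          + (‖(ψ n - φ k) x‖ₑ ^ 2 + ‖(fderiv ℝ (ψ n) - fderiv ℝ (φ k)) x‖ₑ ^ 2)) := by
        refine lintegral_mono fun x => ?_
        refine (add_le_add (hsq (v x) (ψ n x) (φ k x))
          (hsq (Dv x) (fderiv ℝ (ψ n) x) (fderiv ℝ (φ k) x))).trans (le_of_eq ?_)
        simp only [Pi.sub_apply]
        ring
    _ = 2 * (sobolevEnergy Ω (ψ n - v) (fderiv ℝ (ψ n) - Dv)
          + sobolevEnergy Ω (ψ n - φ k) (fderiv ℝ (ψ n) - fderiv ℝ (φ k))) := by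
        rw [lintegral_const_mul' _ _ (by norm_num), lintegral_add_left' hm]
        rfl
    _ ≤ 2 * (ε / 4 + ε / 4) := by
        gcongr
        rw [sobolevEnergy_eq (((hψ n).memLp _).sub hv).1]
        exact hn.le
    _ = ε := by
        rw [← two_mul, ← mul_assoc, show (2 : ℝ≥0∞) * 2 = 4 by norm_num,
          ENNReal.mul_div_cancel (by norm_num) (by norm_num)]

/-- The index of the best approximation among the first `j + 1` candidates. -/
noncomputable def runningArgmin {τ : Type*} (e : ℕ → τ → ℝ≥0∞) : ℕ → τ → ℕ
  | 0, _ => 0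
  | j + 1, t => open Classical in
    if e (j + 1) t < e (runningArgmin e j t) t then j + 1 else runningArgmin e j t

theorem runningArgmin_le {τ : Type*} (e : ℕ → τ → ℝ≥0∞) (j : ℕ) (t : τ) :
    runningArgmin e j t ≤ j := by
  induction j with
  | zero => simp [runningArgmin]
  | succ j ih => rw [runningArgmin]; split_ifs <;> omega

theorem apply_runningArgmin_le {τ : Type*} (e : ℕ → τ → ℝ≥0∞) (t : τ) {j k : ℕ} (h : k ≤ j) :
    e (runningArgmin e j t) t ≤ e k t := by
  induction j with
  | zero => simp [runningArgmin, Nat.le_zero.1 h]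
  | succ j ih =>
    rw [runningArgmin]
    rcases Nat.le_succ_iff.1 h with h | rfl
    · split_ifs with hlt
      · exact hlt.le.trans (ih h)
      · exact ih h
    · split_ifs with hlt
      · exact le_rfl
      · exact not_lt.1 hlt

theorem measurable_runningArgmin {τ : Type*} [MeasurableSpace τ] {e : ℕ → τ → ℝ≥0∞}
    (he : ∀ k, Measurable (e k)) (j : ℕ) : Measurable (runningArgmin e j) := by
  induction j with
  | zero => exact measurable_const
  | succ j ih =>
    have h : Measurable fun t => e (runningArgmin e j t) t :=
      (measurable_from_prod_countable_right (f := fun p : ℕ × τ => e p.1 p.2) he).comp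
        (ih.prodMk measurable_id)
    exact Measurable.ite (measurableSet_lt (he (j + 1)) h) measurable_const ih

theorem exists_simple_approx_of_memW012 {τ : Type*} [MeasurableSpace τ] {μ : Measure τ}
    {u : τ → EuclideanSpace ℝ (Fin N) → EuclideanSpace ℝ (Fin N)}
    {Du : τ → EuclideanSpace ℝ (Fin N) →
      (EuclideanSpace ℝ (Fin N) →L[ℝ] EuclideanSpace ℝ (Fin N))}
    (hu : Measurable fun p : τ × EuclideanSpace ℝ (Fin N) => u p.1 p.2)
    (hDu : Measurable fun p : τ × EuclideanSpace ℝ (Fin N) => Du p.1 p.2)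
    (hW : ∀ᵐ t ∂μ, MemW012 Ω (u t) (Du t))
    (hfin : ∫⁻ t, sobolevEnergy Ω (u t) (Du t) ∂μ < ⊤) :
    ∃ (φ : ℕ → EuclideanSpace ℝ (Fin N) → EuclideanSpace ℝ (Fin N)) (n : ℕ → τ → ℕ),
      (∀ k, IsTestVectorField Ω (φ k)) ∧ (∀ j, Measurable (n j)) ∧ (∀ j t, n j t ≤ j) ∧
      (∀ j, ∫⁻ t, sobolevEnergy Ω (u t - φ (n j t)) (Du t - fderiv ℝ (φ (n j t))) ∂μ
        ≤ ∫⁻ t, sobolevEnergy Ω (u t) (Du t) ∂μ) ∧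
      Tendsto (fun j => ∫⁻ t, sobolevEnergy Ω (u t - φ (n j t)) (Du t - fderiv ℝ (φ (n j t))) ∂μ)
        atTop (𝓝 0) := by
  obtain ⟨φ₀, hφ₀, hdense₀⟩ := exists_seq_dense_testVectorField Ω
  let φ : ℕ → EuclideanSpace ℝ (Fin N) → EuclideanSpace ℝ (Fin N) := fun k => Nat.casesOn k 0 φ₀
  have hφ : ∀ k, IsTestVectorField Ω (φ k) := fun k => by
    cases k with
    | zero => exact ⟨contDiff_const, HasCompactSupport.zero, by simp [φ, tsupport]⟩
    | succ k => exact hφ₀ k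
  have hdense : ∀ ψ, IsTestVectorField Ω ψ → ∀ ε : ℝ≥0∞, ε ≠ 0 →
      ∃ k, sobolevEnergy Ω (ψ - φ k) (fderiv ℝ ψ - fderiv ℝ (φ k)) ≤ ε := fun ψ hψ ε hε => by
    obtain ⟨k, hk⟩ := hdense₀ ψ hψ ε hε
    exact ⟨k + 1, hk⟩
  obtain ⟨e, hedef⟩ : ∃ e : ℕ → τ → ℝ≥0∞,
      ∀ k t, sobolevEnergy Ω (u t - φ k) (Du t - fderiv ℝ (φ k)) = e k t := ⟨_, fun _ _ => rfl⟩
  have he : ∀ k, Measurable (e k) := fun k => by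
    have h1 : Measurable (φ k) := (hφ k).1.continuous.measurable
    have h2 : Measurable (fderiv ℝ (φ k)) :=
      ((hφ k).contDiff_one.continuous_fderiv one_ne_zero).measurable
    rw [← show _ = e k from funext (hedef k)]
    refine Measurable.lintegral_prod_right' (f := fun p : τ × EuclideanSpace ℝ (Fin N) =>
      ‖u p.1 p.2 - φ k p.2‖ₑ ^ 2 + ‖Du p.1 p.2 - fderiv ℝ (φ k) p.2‖ₑ ^ 2) ?_
    exact ((hu.sub (h1.comp measurable_snd)).enorm.pow_const 2).add
      ((hDu.sub (h2.comp measurable_snd)).enorm.pow_const 2)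
  have he0 : e 0 = fun t => sobolevEnergy Ω (u t) (Du t) := by
    ext1 t
    have h0 : fderiv ℝ (φ 0) = 0 := by
      change fderiv ℝ (fun _ => 0) = 0
      simp
    rw [← hedef, h0, sub_zero, show φ 0 = 0 from rfl, sub_zero]
  refine ⟨φ, runningArgmin e, hφ, measurable_runningArgmin he, runningArgmin_le e, fun j => ?_, ?_⟩
  · rw [← he0]
    simp_rw [hedef]
    exact lintegral_mono fun t => apply_runningArgmin_le e t (Nat.zero_le j)
  · have hlim : ∀ᵐ t ∂μ, Tendsto (fun j => e (runningArgmin e j t) t) atTop (𝓝 0) := by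
      have h0 : Measurable fun t => sobolevEnergy Ω (u t) (Du t) := he0 ▸ he 0
      filter_upwards [hW, ae_lt_top h0 hfin.ne] with t ht hlt
      have hut : AEStronglyMeasurable (u t) (volume.restrict Ω) :=
        (hu.comp measurable_prodMk_left).aestronglyMeasurable
      have hDut : AEStronglyMeasurable (Du t) (volume.restrict Ω) :=
        (hDu.comp measurable_prodMk_left).aestronglyMeasurable
      rw [sobolevEnergy_eq hut, ENNReal.add_lt_top] at hlt
      refine ENNReal.tendsto_nhds_zero.2 fun ε hε => ?_
      simp_rw [← hedef]
      obtain ⟨k, hk⟩ := ht.exists_sobolevEnergy_sub_le ⟨hut, by simpa using hlt.1⟩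
        ⟨hDut, by simpa using hlt.2⟩ hdense hε.ne'
      filter_upwards [eventually_ge_atTop k] with j hj
      rw [hedef] at hk ⊢
      exact (apply_runningArgmin_le e t hj).trans hk
    simp_rw [hedef]
    have := tendsto_lintegral_of_dominated_convergence' (e 0)
      (F := fun j t => e (runningArgmin e j t) t) (f := fun _ => 0) (μ := μ)
      (fun j => ?_) (fun j => Eventually.of_forall fun t => apply_runningArgmin_le e t j.zero_le)
      (by rw [he0]; exact hfin.ne) hlim
    · simpa using this
    · exact ((measurable_from_prod_countable_right (f := fun p : ℕ × τ => e p.1 p.2) he).comp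
        ((measurable_runningArgmin he j).prodMk measurable_id)).aemeasurable

end SobolevEnergy

theorem ENNReal.enorm_toReal_sub_le {a b c : ℝ≥0∞} (ha : a ≠ ⊤) (hb : b ≠ ⊤)
    (hab : a ≤ c + b) (hba : b ≤ c + a) : ‖a.toReal - b.toReal‖ₑ ≤ c := by
  by_cases hc : c = ⊤
  · simp [hc]
  lift a to NNReal using ha
  lift b to NNReal using hb
  lift c to NNReal using hc
  have h1 : (a : ℝ) ≤ c + b := by exact_mod_cast hab
  have h2 : (b : ℝ) ≤ c + a := by exact_mod_cast hba
  rw [← ofReal_norm, Real.norm_eq_abs, ENNReal.coe_toReal, ENNReal.coe_toReal]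
  refine (ENNReal.ofReal_le_ofReal (q := c) (abs_le.2 ⟨by linarith, by linarith⟩)).trans ?_
  exact ENNReal.ofReal_coe_nnreal.le

section SliceNorm

variable {τ : Type*} [MeasurableSpace τ] {N : ℕ}

/-- The `L²` norm in the parameter `t` of the zero extension of `w t` outside `Ω`. -/
noncomputable def sliceNorm (μ : Measure τ) (Ω : Set (EuclideanSpace ℝ (Fin N)))
    (w : τ → EuclideanSpace ℝ (Fin N) → EuclideanSpace ℝ (Fin N))
    (x : EuclideanSpace ℝ (Fin N)) : ℝ :=
  (eLpNorm (fun t => Ω.indicator (w t) x) 2 μ).toReal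

variable {μ : Measure τ} {Ω : Set (EuclideanSpace ℝ (Fin N))}
  {w : τ → EuclideanSpace ℝ (Fin N) → EuclideanSpace ℝ (Fin N)}
  {Dw : τ → EuclideanSpace ℝ (Fin N) →
    (EuclideanSpace ℝ (Fin N) →L[ℝ] EuclideanSpace ℝ (Fin N))}

theorem sliceNorm_nonneg (x : EuclideanSpace ℝ (Fin N)) : 0 ≤ sliceNorm μ Ω w x :=
  ENNReal.toReal_nonneg

theorem measurable_indicator_uncurry (hΩ : MeasurableSet Ω)
    (hw : Measurable fun p : τ × EuclideanSpace ℝ (Fin N) => w p.1 p.2) :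
    Measurable fun p : τ × EuclideanSpace ℝ (Fin N) => Ω.indicator (w p.1) p.2 :=
  hw.indicator (measurable_snd hΩ)

theorem measurable_eLpNorm_slice [SFinite μ] (hΩ : MeasurableSet Ω)
    (hw : Measurable fun p : τ × EuclideanSpace ℝ (Fin N) => w p.1 p.2) :
    Measurable fun x => eLpNorm (fun t => Ω.indicator (w t) x) 2 μ := by
  simp_rw [eLpNorm_two_eq_lintegral_rpow]
  exact (Measurable.lintegral_prod_left'
    ((measurable_indicator_uncurry hΩ hw).enorm.pow_const 2)).pow_const _

theorem measurable_sliceNorm [SFinite μ] (hΩ : MeasurableSet Ω)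
    (hw : Measurable fun p : τ × EuclideanSpace ℝ (Fin N) => w p.1 p.2) :
    Measurable (sliceNorm μ Ω w) :=
  (measurable_eLpNorm_slice hΩ hw).ennreal_toReal

theorem lintegral_eLpNorm_slice_sq_le [SFinite μ] (hΩ : MeasurableSet Ω)
    (hw : Measurable fun p : τ × EuclideanSpace ℝ (Fin N) => w p.1 p.2) :
    ∫⁻ x, eLpNorm (fun t => Ω.indicator (w t) x) 2 μ ^ 2
      ≤ ∫⁻ t, sobolevEnergy Ω (w t) (Dw t) ∂μ := by
  simp_rw [eLpNorm_two_sq_eq_lintegral]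
  rw [← lintegral_lintegral_swap
    ((measurable_indicator_uncurry hΩ hw).enorm.pow_const 2).aemeasurable]
  refine lintegral_mono fun t => ?_
  have : ∀ x, ‖Ω.indicator (w t) x‖ₑ ^ 2 = Ω.indicator (fun x => ‖w t x‖ₑ ^ 2) x := fun x => by
    by_cases hx : x ∈ Ω <;> simp [hx]
  simp_rw [this]
  rw [lintegral_indicator hΩ]
  exact lintegral_mono fun x => le_self_add

theorem ae_eLpNorm_slice_ne_top [SFinite μ] (hΩ : MeasurableSet Ω)
    (hw : Measurable fun p : τ × EuclideanSpace ℝ (Fin N) => w p.1 p.2)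
    (hfin : ∫⁻ t, sobolevEnergy Ω (w t) (Dw t) ∂μ < ⊤) :
    ∀ᵐ x, eLpNorm (fun t => Ω.indicator (w t) x) 2 μ ≠ ⊤ := by
  filter_upwards [ae_lt_top ((measurable_eLpNorm_slice (μ := μ) hΩ hw).pow_const 2)
    ((lintegral_eLpNorm_slice_sq_le hΩ hw).trans_lt hfin).ne] with x hx
  simpa using hx.ne

theorem enorm_sliceNorm_le (x : EuclideanSpace ℝ (Fin N)) :
    ‖sliceNorm μ Ω w x‖ₑ ≤ eLpNorm (fun t => Ω.indicator (w t) x) 2 μ := by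
  rw [sliceNorm, Real.enorm_eq_ofReal ENNReal.toReal_nonneg]
  exact ENNReal.ofReal_toReal_le

theorem lintegral_sliceNorm_sq_le [SFinite μ] (hΩ : MeasurableSet Ω)
    (hw : Measurable fun p : τ × EuclideanSpace ℝ (Fin N) => w p.1 p.2) :
    ∫⁻ x, ‖sliceNorm μ Ω w x‖ₑ ^ 2 ≤ ∫⁻ t, sobolevEnergy Ω (w t) (Dw t) ∂μ :=
  (lintegral_mono fun x => pow_le_pow_left' (enorm_sliceNorm_le x) 2).trans
    (lintegral_eLpNorm_slice_sq_le hΩ hw)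

theorem lintegral_translate_sliceNorm_sub_sq_le [SFinite μ] (hΩ : MeasurableSet Ω)
    (hw : Measurable fun p : τ × EuclideanSpace ℝ (Fin N) => w p.1 p.2)
    (hDw : ∀ t, Measurable (Dw t)) (hE : Measurable fun t => sobolevEnergy Ω (w t) (Dw t))
    (hW : ∀ᵐ t ∂μ, MemW012 Ω (w t) (Dw t))
    (hfin : ∫⁻ t, sobolevEnergy Ω (w t) (Dw t) ∂μ < ⊤) (h : EuclideanSpace ℝ (Fin N)) :
    ∫⁻ x, ‖sliceNorm μ Ω w (x + h) - sliceNorm μ Ω w x‖ₑ ^ 2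
      ≤ ‖h‖ₑ ^ 2 * ∫⁻ t, sobolevEnergy Ω (w t) (Dw t) ∂μ := by
  have hI := measurable_indicator_uncurry hΩ hw
  have hIx : ∀ x, AEStronglyMeasurable (fun t => Ω.indicator (w t) x) μ := fun x =>
    (hI.comp measurable_prodMk_right).aestronglyMeasurable
  have hτ := measurePreserving_add_right (volume : Measure (EuclideanSpace ℝ (Fin N))) h
  have hae := ae_eLpNorm_slice_ne_top hΩ hw hfin
  have hm : Measurable fun p : τ × EuclideanSpace ℝ (Fin N) =>
      ‖Ω.indicator (w p.1) (p.2 + h) - Ω.indicator (w p.1) p.2‖ₑ ^ 2 :=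
    ((hI.comp (measurable_fst.prodMk (measurable_snd.add_const h))).sub hI).enorm.pow_const 2
  calc ∫⁻ x, ‖sliceNorm μ Ω w (x + h) - sliceNorm μ Ω w x‖ₑ ^ 2
      ≤ ∫⁻ x, ∫⁻ t, ‖Ω.indicator (w t) (x + h) - Ω.indicator (w t) x‖ₑ ^ 2 ∂μ := by
        refine lintegral_mono_ae ?_
        filter_upwards [hae, hτ.quasiMeasurePreserving.ae hae] with x hx hxh
        rw [← eLpNorm_two_sq_eq_lintegral]
        refine pow_le_pow_left' (ENNReal.enorm_toReal_sub_le hxh hx ?_ ?_) 2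
        · have := eLpNorm_add_le ((hIx (x + h)).sub (hIx x)) (hIx x) (p := 2) (by norm_num)
          rwa [sub_add_cancel] at this
        · have := eLpNorm_add_le ((hIx x).sub (hIx (x + h))) (hIx (x + h)) (p := 2) (by norm_num)
          rw [sub_add_cancel, eLpNorm_sub_comm] at this
          exact this
    _ = ∫⁻ t, ∫⁻ x, ‖Ω.indicator (w t) (x + h) - Ω.indicator (w t) x‖ₑ ^ 2 ∂volume ∂μ :=
        (lintegral_lintegral_swap hm.aemeasurable).symm
    _ ≤ ∫⁻ t, ‖h‖ₑ ^ 2 * sobolevEnergy Ω (w t) (Dw t) ∂μ := by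
        refine lintegral_mono_ae ?_
        filter_upwards [hW, ae_lt_top hE hfin.ne] with t ht hlt
        have hwt : AEStronglyMeasurable (w t) (volume.restrict Ω) :=
          (hw.comp measurable_prodMk_left).aestronglyMeasurable
        have hlt' := hlt
        rw [sobolevEnergy_eq hwt, ENNReal.add_lt_top] at hlt'
        refine (ht.lintegral_translate_sub_sq_le hΩ ⟨hwt, by simpa using hlt'.1⟩
          ⟨(hDw t).aestronglyMeasurable, by simpa using hlt'.2⟩ h).trans ?_
        gcongr
        exact lintegral_mono fun x => le_add_self
    _ = _ := lintegral_const_mul' _ _ (by finiteness)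

end SliceNorm

theorem MemW012.sub_testVectorField {N : ℕ} {Ω : Set (EuclideanSpace ℝ (Fin N))}
    {v : EuclideanSpace ℝ (Fin N) → EuclideanSpace ℝ (Fin N)}
    {Dv : EuclideanSpace ℝ (Fin N) → (EuclideanSpace ℝ (Fin N) →L[ℝ] EuclideanSpace ℝ (Fin N))}
    (h : MemW012 Ω v Dv) {ψ : EuclideanSpace ℝ (Fin N) → EuclideanSpace ℝ (Fin N)}
    (hψ : IsTestVectorField Ω ψ) : MemW012 Ω (v - ψ) (Dv - fderiv ℝ ψ) := by
  obtain ⟨φ, hφ, h1, h2⟩ := h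
  refine ⟨fun n => φ n - ψ, fun n => ⟨(hφ n).1.sub hψ.1, (hφ n).2.1.sub hψ.2.1,
    (tsupport_sub _ _).trans (Set.union_subset (hφ n).2.2 hψ.2.2)⟩, ?_, ?_⟩
  · simpa using h1
  · have : ∀ n x, fderiv ℝ (φ n - ψ) x - (Dv - fderiv ℝ ψ) x = fderiv ℝ (φ n) x - Dv x := by
      intro n x
      rw [fderiv_sub ((hφ n).contDiff_one.differentiable one_ne_zero x)
        (hψ.contDiff_one.differentiable one_ne_zero x), Pi.sub_apply]
      abel
    simpa only [this] using h2

theorem max_sub_div_mem_Icc {P D : ℝ} (hP : 0 ≤ P) (hD : 0 ≤ D) :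
    max (P - D) 0 / P ∈ Set.Icc (0 : ℝ) 1 :=
  ⟨div_nonneg (le_max_right _ _) hP, div_le_one_of_le₀ (max_le (by linarith) hP) hP⟩

theorem mul_max_sub_div {P D : ℝ} (hP : 0 ≤ P) (hD : 0 ≤ D) :
    P * (max (P - D) 0 / P) = max (P - D) 0 := by
  rcases hP.eq_or_lt with rfl | hP
  · simp [hD]
  · field_simp

theorem abs_mul_max_sub_div_sub_one_le {P D : ℝ} (hP : 0 ≤ P) (hD : 0 ≤ D) :
    |P * (max (P - D) 0 / P - 1)| ≤ D := by
  rw [mul_sub, mul_max_sub_div hP hD, mul_one, abs_le]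
  constructor
  · linarith [le_max_left (P - D) 0]
  · linarith [max_le (show P - D ≤ P + D by linarith) (show (0 : ℝ) ≤ P + D by linarith)]

theorem abs_mul_max_sub_div_sub_le {P D P' D' : ℝ} (hP : 0 ≤ P) (hD : 0 ≤ D) (hP' : 0 ≤ P')
    (hD' : 0 ≤ D') :
    |P * (max (P' - D') 0 / P' - max (P - D) 0 / P)| ≤ 2 * |P' - P| + |D' - D| := by
  obtain ⟨h0, h1⟩ := max_sub_div_mem_Icc hP' hD'
  have e : P * (max (P' - D') 0 / P' - max (P - D) 0 / P)
      = (max (P' - D') 0 - max (P - D) 0) - (P' - P) * (max (P' - D') 0 / P') := by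
    rw [mul_sub, mul_max_sub_div hP hD, sub_mul, mul_max_sub_div hP' hD']
    ring
  have h2 : |max (P' - D') 0 - max (P - D) 0| ≤ |P' - P| + |D' - D| := by
    refine (abs_max_sub_max_le_abs _ _ _).trans ?_
    rw [show P' - D' - (P - D) = (P' - P) - (D' - D) by ring]
    exact abs_sub _ _
  have h3 : |(P' - P) * (max (P' - D') 0 / P')| ≤ |P' - P| := by
    rw [abs_mul, abs_of_nonneg h0]
    exact mul_le_of_le_one_right (abs_nonneg _) h1
  rw [e]
  refine (abs_sub _ _).trans ?_
  linarith

section Profile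

variable {E : Type*} [NormedAddCommGroup E] [InnerProductSpace ℝ E] [FiniteDimensional ℝ E]
  [MeasurableSpace E] [BorelSpace E]

theorem exists_cutoff_of_approx (μ : Measure E) [μ.IsAddHaarMeasure] :
    ∃ C : ℝ≥0∞, C ≠ ⊤ ∧ ∀ Ω K : Set E, IsOpen Ω → Bornology.IsBounded Ω → IsCompact K → K ⊆ Ω →
      ∀ U d : E → ℝ, Measurable U → Measurable d → (∀ x, 0 ≤ U x) → (∀ x, 0 ≤ d x) →
      (∀ x ∉ K, d x = U x) → (∀ x ∉ Ω, U x = 0) → ∀ A : ℝ≥0∞, A ≠ ⊤ →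
      (∀ h : E, ∫⁻ x, ‖U (x + h) - U x‖ₑ ^ 2 ∂μ ≤ ‖h‖ₑ ^ 2 * A) →
      (∀ h : E, ∫⁻ x, ‖d (x + h) - d x‖ₑ ^ 2 ∂μ ≤ ‖h‖ₑ ^ 2 * A) →
      ∀ δ : ℝ, 0 < δ → ∃ θ : E → ℝ, ContDiff ℝ (⊤ : ℕ∞) θ ∧ HasCompactSupport θ ∧
        tsupport θ ⊆ Ω ∧ (∀ x, θ x ∈ Set.Icc (0 : ℝ) 1) ∧
        ∫⁻ x in Ω, ‖U x + Metric.infDist x Ωᶜ‖ₑ ^ 2 * ‖fderiv ℝ θ x‖ₑ ^ 2 ∂μ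
          ≤ C * (12 * A + 36 * μ Ω) ∧
        ∫⁻ x in Ω, ‖(U x + Metric.infDist x Ωᶜ) * (θ x - 1)‖ₑ ^ 2 ∂μ
          ≤ 2 * (ENNReal.ofReal δ
            + 2 * ((∫⁻ x, ‖d x‖ₑ ^ 2 ∂μ) + ENNReal.ofReal δ ^ 2 * μ Ω)) := by
  obtain ⟨C, hC, hmoll⟩ := exists_mollified_cutoff μ
  refine ⟨C, hC, ?_⟩
  intro Ω K hΩ hΩb hK hKΩ U d hUm hdm hU0 hd0 hdU hUΩ A hA hUA hdA δ hδ
  set z : E → ℝ := fun x => Metric.infDist x Ωᶜ with hz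
  have hzc : Continuous z := Metric.continuous_infDist_pt _
  have hz0 : ∀ x, 0 ≤ z x := fun x => Metric.infDist_nonneg
  have hzΩ : ∀ x ∉ Ω, z x = 0 := fun x hx => Metric.infDist_zero_of_mem hx
  have hzL : ∀ x h, |z (x + h) - z x| ≤ ‖h‖ := fun x h => by
    have := (Metric.lipschitz_infDist_pt Ωᶜ).dist_le_mul (x + h) x
    simpa [Real.dist_eq] using this
  have hmL : ∀ x h, |min (z (x + h)) δ - min (z x) δ| ≤ ‖h‖ := fun x h => by
    refine (abs_min_sub_min_le_max _ _ _ _).trans (max_le (hzL x h) ?_)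
    simp
  set P : E → ℝ := fun x => U x + z x with hP
  set D : E → ℝ := fun x => d x + min (z x) δ with hD
  have hP0 : ∀ x, 0 ≤ P x := fun x => add_nonneg (hU0 x) (hz0 x)
  have hD0 : ∀ x, 0 ≤ D x := fun x => add_nonneg (hd0 x) (le_min (hz0 x) hδ.le)
  have hPm : Measurable P := hUm.add hzc.measurable
  have hDm : Measurable D := hdm.add (hzc.measurable.min measurable_const)
  set χ : E → ℝ := fun x => max (P x - D x) 0 / P x with hχ
  have hχm : Measurable χ := ((hPm.sub hDm).max measurable_const).div hPm
  have hV : μ Ω ≠ ⊤ := hΩb.measure_lt_top.ne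
  have hK' : IsCompact (K ∪ {x | δ ≤ z x}) := by
    refine hK.union (Metric.isCompact_of_isClosed_isBounded
      (isClosed_le continuous_const hzc) (hΩb.subset fun x hx => ?_))
    by_contra h
    simp only [Set.mem_ofPred_eq, hzΩ x h] at hx
    linarith
  have hKΩ' : K ∪ {x | δ ≤ z x} ⊆ Ω := by
    refine Set.union_subset hKΩ fun x hx => ?_
    by_contra h
    simp only [Set.mem_ofPred_eq, hzΩ x h] at hx
    linarith
  have hχK : ∀ x ∉ K ∪ {x | δ ≤ z x}, χ x = 0 := fun x hx => by
    simp only [Set.mem_union, Set.mem_ofPred_eq, not_or, not_le] at hx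
    simp [hχ, hP, hD, hdU x hx.1, min_eq_left hx.2.le]
  have hbound : ∀ h : E, ∫⁻ x in Ω, ‖P x * (χ (x + h) - χ x)‖ₑ ^ 2 ∂μ
      ≤ (12 * A + 36 * μ Ω) * ‖h‖ₑ ^ 2 := by
    intro h
    have hpt : ∀ x, ‖P x * (χ (x + h) - χ x)‖ₑ ^ 2
        ≤ 8 * ‖U (x + h) - U x‖ₑ ^ 2 + (4 * ‖d (x + h) - d x‖ₑ ^ 2 + 36 * ‖h‖ₑ ^ 2) := by
      intro x
      have h1 : |P x * (χ (x + h) - χ x)|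
          ≤ 2 * |U (x + h) - U x| + (|d (x + h) - d x| + 3 * ‖h‖) := by
        refine (abs_mul_max_sub_div_sub_le (hP0 x) (hD0 x) (hP0 (x + h)) (hD0 (x + h))).trans ?_
        have h2 : |P (x + h) - P x| ≤ |U (x + h) - U x| + ‖h‖ := by
          rw [show P (x + h) - P x = (U (x + h) - U x) + (z (x + h) - z x) by
            simp only [hP]; ring]
          exact (abs_add_le _ _).trans (by linarith [hzL x h])
        have h3 : |D (x + h) - D x| ≤ |d (x + h) - d x| + ‖h‖ := by
          rw [show D (x + h) - D x = (d (x + h) - d x) + (min (z (x + h)) δ - min (z x) δ) by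
            simp only [hD]; ring]
          exact (abs_add_le _ _).trans (by linarith [hmL x h])
        linarith
      have h4 : ‖P x * (χ (x + h) - χ x)‖ₑ
          ≤ 2 * ‖U (x + h) - U x‖ₑ + (‖d (x + h) - d x‖ₑ + 3 * ‖h‖ₑ) := by
        have := ENNReal.ofReal_le_ofReal h1
        rw [ENNReal.ofReal_add (by positivity) (by positivity),
          ENNReal.ofReal_add (by positivity) (by positivity),
          ENNReal.ofReal_mul (by norm_num), ENNReal.ofReal_mul (by norm_num)] at this
        simpa [Real.enorm_eq_ofReal_abs, ← ofReal_norm] using this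
      calc _ ≤ _ := pow_le_pow_left' h4 2
        _ ≤ _ := ENNReal.add_sq_le_two_mul _ _
        _ ≤ 2 * ((2 * ‖U (x + h) - U x‖ₑ) ^ 2
              + 2 * (‖d (x + h) - d x‖ₑ ^ 2 + (3 * ‖h‖ₑ) ^ 2)) := by
            gcongr
            exact ENNReal.add_sq_le_two_mul _ _
        _ = _ := by ring
    calc ∫⁻ x in Ω, ‖P x * (χ (x + h) - χ x)‖ₑ ^ 2 ∂μ
        ≤ ∫⁻ x in Ω, (8 * ‖U (x + h) - U x‖ₑ ^ 2
            + (4 * ‖d (x + h) - d x‖ₑ ^ 2 + 36 * ‖h‖ₑ ^ 2)) ∂μ := lintegral_mono hpt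
      _ = 8 * (∫⁻ x in Ω, ‖U (x + h) - U x‖ₑ ^ 2 ∂μ)
            + (4 * (∫⁻ x in Ω, ‖d (x + h) - d x‖ₑ ^ 2 ∂μ) + 36 * ‖h‖ₑ ^ 2 * μ Ω) := by
          rw [lintegral_add_left (by fun_prop), lintegral_add_left (by fun_prop),
            lintegral_const_mul' _ _ (by norm_num), lintegral_const_mul' _ _ (by norm_num),
            setLIntegral_const]
      _ ≤ 8 * (‖h‖ₑ ^ 2 * A) + (4 * (‖h‖ₑ ^ 2 * A) + 36 * ‖h‖ₑ ^ 2 * μ Ω) := by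
          gcongr
          · exact (setLIntegral_le_lintegral _ _).trans (hUA h)
          · exact (setLIntegral_le_lintegral _ _).trans (hdA h)
      _ = _ := by ring
  obtain ⟨θ, h1, h2, h3, h4, h5, h6⟩ := hmoll Ω _ hΩ hK' hKΩ' P χ hPm hχm
    (fun x => max_sub_div_mem_Icc (hP0 x) (hD0 x)) hχK _ (by finiteness) hbound
    (ENNReal.ofReal δ) (by simpa using hδ)
  refine ⟨θ, h1, h2, h3, h4, h5, ?_⟩
  have hpt : ∀ x, ‖P x * (θ x - 1)‖ₑ ^ 2
      ≤ 2 * (‖P x‖ₑ ^ 2 * ‖θ x - χ x‖ₑ ^ 2 + 2 * (‖d x‖ₑ ^ 2 + ENNReal.ofReal δ ^ 2)) := fun x => by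
    have h7 : ‖P x * (χ x - 1)‖ₑ ≤ ‖d x‖ₑ + ENNReal.ofReal δ := by
      rw [Real.enorm_eq_ofReal_abs, Real.enorm_eq_ofReal (hd0 x),
        ← ENNReal.ofReal_add (hd0 x) hδ.le]
      refine ENNReal.ofReal_le_ofReal
        ((abs_mul_max_sub_div_sub_one_le (hP0 x) (hD0 x)).trans ?_)
      simp only [hD]
      gcongr
      exact min_le_right _ _
    calc ‖P x * (θ x - 1)‖ₑ ^ 2
        = ‖P x * (θ x - χ x) + P x * (χ x - 1)‖ₑ ^ 2 := by ring_nf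
      _ ≤ (‖P x * (θ x - χ x)‖ₑ + ‖P x * (χ x - 1)‖ₑ) ^ 2 := by
          gcongr
          exact enorm_add_le _ _
      _ ≤ 2 * (‖P x * (θ x - χ x)‖ₑ ^ 2 + ‖P x * (χ x - 1)‖ₑ ^ 2) := ENNReal.add_sq_le_two_mul _ _
      _ ≤ 2 * (‖P x * (θ x - χ x)‖ₑ ^ 2 + (‖d x‖ₑ + ENNReal.ofReal δ) ^ 2) := by gcongr
      _ ≤ _ := by
          rw [enorm_mul, mul_pow]
          gcongr
          exact ENNReal.add_sq_le_two_mul _ _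
  calc ∫⁻ x in Ω, ‖P x * (θ x - 1)‖ₑ ^ 2 ∂μ
      ≤ ∫⁻ x in Ω, 2 * (‖P x‖ₑ ^ 2 * ‖θ x - χ x‖ₑ ^ 2
          + 2 * (‖d x‖ₑ ^ 2 + ENNReal.ofReal δ ^ 2)) ∂μ := lintegral_mono hpt
    _ = 2 * ((∫⁻ x in Ω, ‖P x‖ₑ ^ 2 * ‖θ x - χ x‖ₑ ^ 2 ∂μ)
          + 2 * ((∫⁻ x in Ω, ‖d x‖ₑ ^ 2 ∂μ) + ENNReal.ofReal δ ^ 2 * μ Ω)) := by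
        have hθm : Measurable θ := h1.continuous.measurable
        rw [lintegral_const_mul' _ _ (by norm_num), lintegral_add_left (by fun_prop),
          lintegral_const_mul' _ _ (by norm_num), lintegral_add_left (by fun_prop),
          setLIntegral_const]
    _ ≤ _ := by
        gcongr
        exact Measure.restrict_le_self

end Profile

theorem exists_cutoff_seq {τ : Type*} [MeasurableSpace τ] {μ : Measure τ} [SFinite μ] {N : ℕ}
    {Ω : Set (EuclideanSpace ℝ (Fin N))} (hΩ : IsOpen Ω) (hΩb : Bornology.IsBounded Ω)
    (hΩc : Ωᶜ.Nonempty)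
    {u : τ → EuclideanSpace ℝ (Fin N) → EuclideanSpace ℝ (Fin N)}
    {Du : τ → EuclideanSpace ℝ (Fin N) →
      (EuclideanSpace ℝ (Fin N) →L[ℝ] EuclideanSpace ℝ (Fin N))}
    (hu : Measurable fun p : τ × EuclideanSpace ℝ (Fin N) => u p.1 p.2)
    (hDu : Measurable fun p : τ × EuclideanSpace ℝ (Fin N) => Du p.1 p.2)
    (hW : ∀ᵐ t ∂μ, MemW012 Ω (u t) (Du t))
    (hfin : ∫⁻ t, sobolevEnergy Ω (u t) (Du t) ∂μ < ⊤) :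
    ∃ (C : ℝ≥0∞) (θ : ℕ → EuclideanSpace ℝ (Fin N) → ℝ), C ≠ ⊤ ∧
      (∀ n, ContDiff ℝ (⊤ : ℕ∞) (θ n) ∧ HasCompactSupport (θ n) ∧ tsupport (θ n) ⊆ Ω ∧
        ∀ x, θ n x ∈ Set.Icc (0 : ℝ) 1) ∧
      (∀ n, ∫⁻ x in Ω, (∫⁻ t, ‖u t x‖ₑ ^ 2 ∂μ) * ‖fderiv ℝ (θ n) x‖ₑ ^ 2 ≤ C) ∧
      ∀ᵐ x ∂volume.restrict Ω, Tendsto (fun n => θ n x) atTop (𝓝 1) := by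
  have hΩm := hΩ.measurableSet
  obtain ⟨φ, n, hφ, hn, hnj, hle, hlim⟩ := exists_simple_approx_of_memW012 hu hDu hW hfin
  set A := ∫⁻ t, sobolevEnergy Ω (u t) (Du t) ∂μ with hA
  have hφm : Measurable fun p : ℕ × EuclideanSpace ℝ (Fin N) => φ p.1 p.2 :=
    measurable_from_prod_countable_right fun k => (hφ k).1.continuous.measurable
  have hDφm : Measurable fun p : ℕ × EuclideanSpace ℝ (Fin N) => fderiv ℝ (φ p.1) p.2 :=
    measurable_from_prod_countable_right fun k =>
      ((hφ k).contDiff_one.continuous_fderiv one_ne_zero).measurable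
  have hEm : ∀ {w : τ → EuclideanSpace ℝ (Fin N) → EuclideanSpace ℝ (Fin N)}
      {Dw : τ → EuclideanSpace ℝ (Fin N) →
        (EuclideanSpace ℝ (Fin N) →L[ℝ] EuclideanSpace ℝ (Fin N))},
      (Measurable fun p : τ × EuclideanSpace ℝ (Fin N) => w p.1 p.2) →
      (Measurable fun p : τ × EuclideanSpace ℝ (Fin N) => Dw p.1 p.2) →
      Measurable fun t => sobolevEnergy Ω (w t) (Dw t) := fun hw hDw =>
    Measurable.lintegral_prod_right' ((hw.enorm.pow_const 2).add (hDw.enorm.pow_const 2))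
  let w : ℕ → τ → EuclideanSpace ℝ (Fin N) → EuclideanSpace ℝ (Fin N) :=
    fun j t => u t - φ (n j t)
  let Dw : ℕ → τ → EuclideanSpace ℝ (Fin N) →
      (EuclideanSpace ℝ (Fin N) →L[ℝ] EuclideanSpace ℝ (Fin N)) :=
    fun j t => Du t - fderiv ℝ (φ (n j t))
  have hnm : ∀ j, Measurable fun p : τ × EuclideanSpace ℝ (Fin N) => (n j p.1, p.2) := fun j =>
    ((hn j).comp measurable_fst).prodMk measurable_snd
  have hw : ∀ j, Measurable fun p : τ × EuclideanSpace ℝ (Fin N) => w j p.1 p.2 := fun j =>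
    hu.sub (hφm.comp (hnm j))
  have hDw : ∀ j, Measurable fun p : τ × EuclideanSpace ℝ (Fin N) => Dw j p.1 p.2 := fun j =>
    hDu.sub (hDφm.comp (hnm j))
  have hV : volume Ω ≠ ⊤ := hΩb.measure_lt_top.ne
  obtain ⟨C, hC, hcut⟩ :=
    exists_cutoff_of_approx (volume : Measure (EuclideanSpace ℝ (Fin N)))
  have hKc : ∀ j : ℕ, IsCompact (⋃ k ∈ Finset.range (j + 1), tsupport (φ k)) := fun j =>
    (Finset.range (j + 1)).isCompact_biUnion fun k _ => (hφ k).2.1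
  have hstep := fun j : ℕ => hcut Ω _ hΩ hΩb (hKc j)
    (Set.iUnion₂_subset fun k _ => (hφ k).2.2) (sliceNorm μ Ω u) (sliceNorm μ Ω (w j))
    (measurable_sliceNorm hΩm hu) (measurable_sliceNorm hΩm (hw j))
    (fun _ => sliceNorm_nonneg _) (fun _ => sliceNorm_nonneg _)
    (fun x hx => by
      have : ∀ t, φ (n j t) x = 0 := fun t => image_eq_zero_of_notMem_tsupport fun h =>
        hx (Set.mem_biUnion (by simpa using Nat.lt_succ_of_le (hnj j t)) h)
      have heq : (fun t => Ω.indicator (w j t) x) = fun t => Ω.indicator (u t) x := by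
        funext t
        by_cases hxΩ : x ∈ Ω <;> simp [hxΩ, w, this]
      simp only [sliceNorm, heq])
    (fun x hx => by simp [sliceNorm, hx])
    A hfin.ne
    (lintegral_translate_sliceNorm_sub_sq_le hΩm hu
      (fun t => hDu.comp measurable_prodMk_left) (hEm hu hDu) hW hfin)
    (fun h => (lintegral_translate_sliceNorm_sub_sq_le hΩm (hw j) (Dw := Dw j)
      (fun t => (hDw j).comp measurable_prodMk_left) (hEm (hw j) (hDw j))
      (hW.mono fun t ht => ht.sub_testVectorField (hφ _)) ((hle j).trans_lt hfin) h).trans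
      (mul_le_mul_right (hle j) _))
    (1 / ((j : ℝ) + 1)) (by positivity)
  choose θ h1 h2 h3 h4 h5 h6 using hstep
  set P : EuclideanSpace ℝ (Fin N) → ℝ := fun x => sliceNorm μ Ω u x + Metric.infDist x Ωᶜ with hP
  have hPm : Measurable P :=
    (measurable_sliceNorm hΩm hu).add (Metric.continuous_infDist_pt _).measurable
  have hconv : Tendsto (fun j => eLpNorm ((fun x => P x * (θ j x - 1)) - 0) 2 (volume.restrict Ω))
      atTop (𝓝 0) := by
    have hδ : Tendsto (fun j : ℕ => ENNReal.ofReal (1 / ((j : ℝ) + 1))) atTop (𝓝 0) := by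
      simpa using ENNReal.tendsto_ofReal tendsto_one_div_add_atTop_nhds_zero_nat
    have hd : Tendsto (fun j => ∫⁻ x, ‖sliceNorm μ Ω (w j) x‖ₑ ^ 2) atTop (𝓝 0) :=
      tendsto_of_tendsto_of_tendsto_of_le_of_le tendsto_const_nhds hlim (fun _ => zero_le)
        fun j => lintegral_sliceNorm_sq_le hΩm (hw j)
    have hsum := ENNReal.Tendsto.const_mul (a := 2) (hδ.add (ENNReal.Tendsto.const_mul (a := 2)
      (hd.add (ENNReal.Tendsto.mul_const (ENNReal.Tendsto.pow (n := 2) hδ)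
        (Or.inr hV))) (Or.inr (by norm_num)))) (Or.inr (by norm_num))
    have hsq := (tendsto_of_tendsto_of_tendsto_of_le_of_le tendsto_const_nhds
      (by simpa using hsum) (fun _ => zero_le) h6).ennrpow_const (1 / 2 : ℝ)
    simpa [eLpNorm_two_eq_lintegral_rpow] using hsq
  obtain ⟨ns, -, hns⟩ := (tendstoInMeasure_of_tendsto_eLpNorm (by norm_num)
    (fun j => (hPm.mul ((h1 j).continuous.measurable.sub_const 1)).aestronglyMeasurable)
    aestronglyMeasurable_zero hconv).exists_seq_tendsto_ae
  refine ⟨C * (12 * A + 36 * volume Ω), fun k => θ (ns k), by finiteness [hfin.ne],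
    fun k => ⟨h1 _, h2 _, h3 _, h4 _⟩, fun k => le_trans ?_ (h5 (ns k)), ?_⟩
  · refine lintegral_mono_ae ?_
    filter_upwards [ae_restrict_of_ae (ae_eLpNorm_slice_ne_top hΩm hu hfin),
      ae_restrict_mem hΩm] with x hx hxΩ
    gcongr
    have : ∀ t, u t x = Ω.indicator (u t) x := fun t => by simp [hxΩ]
    simp_rw [this]
    rw [← eLpNorm_two_sq_eq_lintegral, ← ENNReal.ofReal_toReal hx]
    gcongr
    rw [Real.enorm_eq_ofReal (add_nonneg (sliceNorm_nonneg _) Metric.infDist_nonneg)]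
    exact ENNReal.ofReal_le_ofReal (le_add_of_nonneg_right Metric.infDist_nonneg)
  · filter_upwards [hns, ae_restrict_mem hΩm] with x hx hxΩ
    have hPx : 0 < P x := add_pos_of_nonneg_of_pos (sliceNorm_nonneg _)
      ((hΩ.isClosed_compl.notMem_iff_infDist_pos hΩc).1 (by simpa using hxΩ))
    have := (hx.const_mul (P x)⁻¹).add_const 1
    simpa [← mul_assoc, inv_mul_cancel₀ hPx.ne'] using this

theorem fderiv_prodMk_left {F : Type*} [NormedAddCommGroup F] [NormedSpace ℝ F]
    {g : ℝ × F → ℝ} (hg : Differentiable ℝ g) (t : ℝ) (x v : F) :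
    fderiv ℝ (fun y => g (t, y)) x v = fderiv ℝ g (t, x) (0, v) := by
  have h := (hg (t, x)).hasFDerivAt.comp x (hasFDerivAt_prodMk_right t x)
  rw [show (fun y => g (t, y)) = g ∘ fun y => (t, y) from rfl, h.fderiv]
  simp

theorem deriv_prodMk_right {F : Type*} [NormedAddCommGroup F] [NormedSpace ℝ F]
    {g : ℝ × F → ℝ} (hg : Differentiable ℝ g) (t : ℝ) (x : F) :
    deriv (fun s => g (s, x)) t = fderiv ℝ g (t, x) (1, 0) := by
  have h := (hg (t, x)).hasFDerivAt.comp_hasDerivAt t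
    ((hasDerivAt_id t).prodMk (hasDerivAt_const t x))
  exact h.deriv

theorem tendsto_integral_mul_fderiv_cutoff {N : ℕ} {μ : Measure ℝ} [IsFiniteMeasure μ]
    {Ω : Set (EuclideanSpace ℝ (Fin N))} [IsFiniteMeasure (volume.restrict Ω)]
    {u : ℝ → EuclideanSpace ℝ (Fin N) → EuclideanSpace ℝ (Fin N)}
    {Du : ℝ → EuclideanSpace ℝ (Fin N) →
      (EuclideanSpace ℝ (Fin N) →L[ℝ] EuclideanSpace ℝ (Fin N))}
    (hW : ∀ᵐ t ∂μ, MemW012 Ω (u t) (Du t))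
    (hu : Measurable fun p : ℝ × EuclideanSpace ℝ (Fin N) => u p.1 p.2)
    (hDu : Measurable fun p : ℝ × EuclideanSpace ℝ (Fin N) => Du p.1 p.2)
    (hu2 : MemLp (fun p : ℝ × EuclideanSpace ℝ (Fin N) => u p.1 p.2) 2
      (μ.prod (volume.restrict Ω)))
    (hDu2 : MemLp (fun p : ℝ × EuclideanSpace ℝ (Fin N) => Du p.1 p.2) 2
      (μ.prod (volume.restrict Ω)))
    {θ : ℕ → EuclideanSpace ℝ (Fin N) → ℝ} (hθ : ∀ n, ContDiff ℝ 1 (θ n))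
    (hθs : ∀ n, HasCompactSupport (θ n)) (hθ01 : ∀ n x, θ n x ∈ Set.Icc (0 : ℝ) 1)
    (hlim : ∀ᵐ x ∂volume.restrict Ω, Tendsto (fun n => θ n x) atTop (𝓝 1))
    {g : ℝ × EuclideanSpace ℝ (Fin N) → ℝ} (hg : ContDiff ℝ 1 g) (hgs : HasCompactSupport g) :
    Tendsto (fun n => ∫ p, g p * fderiv ℝ (θ n) p.2 (u p.1 p.2) ∂μ.prod (volume.restrict Ω))
      atTop (𝓝 0) := by
  have hgd : Differentiable ℝ g := hg.differentiable one_ne_zero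
  have hgc : Continuous (fderiv ℝ g) := hg.continuous_fderiv one_ne_zero
  obtain ⟨K, hK⟩ := hgs.exists_bound_of_continuous hg.continuous
  obtain ⟨K', hK'⟩ := (hgs.fderiv ℝ).exists_bound_of_continuous hgc
  have hui := hu2.integrable (by norm_num)
  have hDui := hDu2.integrable (by norm_num)
  set F : ℝ × EuclideanSpace ℝ (Fin N) → ℝ := fun p =>
    fderiv ℝ g p (0, u p.1 p.2) + g p * euclideanTrace N (Du p.1 p.2) with hF
  have hFi : Integrable F (μ.prod (volume.restrict Ω)) := by
    refine Integrable.add ?_ ?_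
    · refine (hui.norm.const_mul K').mono' ?_ (Eventually.of_forall fun p => ?_)
      · exact isBoundedBilinearMap_apply.continuous.comp_aestronglyMeasurable
          (hgc.aestronglyMeasurable.prodMk (aestronglyMeasurable_const.prodMk hu2.1))
      · refine ((fderiv ℝ g p).le_opNorm _).trans ?_
        rw [Prod.norm_mk, norm_zero, max_eq_right (norm_nonneg _)]
        gcongr
        exact hK' p
    · exact ((euclideanTrace N).integrable_comp hDui).bdd_mul
        hg.continuous.aestronglyMeasurable (Eventually.of_forall hK)
  have hθ1 : ∀ n x, ‖θ n x - 1‖ ≤ 1 := fun n x => by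
    obtain ⟨h0, h1⟩ := hθ01 n x
    rw [Real.norm_eq_abs, abs_le]
    constructor <;> linarith
  have hθm : ∀ n, AEStronglyMeasurable (fun p : ℝ × EuclideanSpace ℝ (Fin N) => θ n p.2 - 1)
      (μ.prod (volume.restrict Ω)) := fun n =>
    (((hθ n).continuous.comp continuous_snd).sub continuous_const).aestronglyMeasurable
  have hFni : ∀ n, Integrable (fun p : ℝ × EuclideanSpace ℝ (Fin N) => (θ n p.2 - 1) * F p)
      (μ.prod (volume.restrict Ω)) := fun n =>
    hFi.bdd_mul (hθm n) (Eventually.of_forall fun p => hθ1 n p.2)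
  have hgi : ∀ n, Integrable (fun p : ℝ × EuclideanSpace ℝ (Fin N) =>
      g p * fderiv ℝ (θ n) p.2 (u p.1 p.2)) (μ.prod (volume.restrict Ω)) := fun n => by
    have hθc := (hθ n).continuous_fderiv one_ne_zero
    obtain ⟨L, hL⟩ := ((hθs n).fderiv ℝ).exists_bound_of_continuous hθc
    refine Integrable.bdd_mul ?_ hg.continuous.aestronglyMeasurable (Eventually.of_forall hK)
    refine (hui.norm.const_mul L).mono' ?_ (Eventually.of_forall fun p => ?_)
    · exact isBoundedBilinearMap_apply.continuous.comp_aestronglyMeasurable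
        ((hθc.comp continuous_snd).aestronglyMeasurable.prodMk hu2.1)
    · exact ((fderiv ℝ (θ n) p.2).le_opNorm _).trans (by gcongr; exact hL _)
  have hslice : ∀ᵐ t ∂μ, MemLp (u t) 2 (volume.restrict Ω) ∧
      MemLp (Du t) 2 (volume.restrict Ω) := by
    filter_upwards [((memLp_two_iff_integrable_sq_norm hu2.1).1 hu2).prod_right_ae,
      ((memLp_two_iff_integrable_sq_norm hDu2.1).1 hDu2).prod_right_ae] with t h1 h2
    exact ⟨(memLp_two_iff_integrable_sq_norm
        (hu.comp measurable_prodMk_left).aestronglyMeasurable).2 h1,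
      (memLp_two_iff_integrable_sq_norm
        (hDu.comp measurable_prodMk_left).aestronglyMeasurable).2 h2⟩
  have hibp : ∀ n, ∫ p, (g p * fderiv ℝ (θ n) p.2 (u p.1 p.2) + (θ n p.2 - 1) * F p)
      ∂μ.prod (volume.restrict Ω) = 0 := fun n => by
    refine (integral_prod _ ((hgi n).add (hFni n))).trans (integral_eq_zero_of_ae ?_)
    filter_upwards [hW, hslice] with t ht hs
    have hgt : ContDiff ℝ 1 fun y => g (t, y) := hg.comp (contDiff_prodMk_right t)
    have hgts : HasCompactSupport fun y => g (t, y) :=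
      HasCompactSupport.intro (IsCompact.image hgs continuous_snd) fun y hy =>
        image_eq_zero_of_notMem_tsupport fun h => hy ⟨(t, y), h, rfl⟩
    have h := ht.setIntegral_fderiv_apply_add_mul_euclideanTrace hs.1 hs.2
      (q := fun y => g (t, y) * (θ n y - 1)) (hgt.mul ((hθ n).sub contDiff_const))
      hgts.mul_right
    rw [Pi.zero_apply, ← h]
    refine integral_congr_ae (Eventually.of_forall fun x => ?_)
    have hd : fderiv ℝ (fun y => g (t, y) * (θ n y - 1)) x (u t x)
        = g (t, x) * fderiv ℝ (θ n) x (u t x)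
          + (θ n x - 1) * fderiv ℝ g (t, x) (0, u t x) := by
      have hθd := (hθ n).differentiable one_ne_zero
      rw [fderiv_fun_mul (hgt.differentiable one_ne_zero x) ((hθd x).sub_const 1),
        fderiv_sub_const, ← fderiv_prodMk_left hgd]
      simp
    simp only [hd, hF, Pi.add_apply]
    ring
  have heq : ∀ n, ∫ p, g p * fderiv ℝ (θ n) p.2 (u p.1 p.2) ∂μ.prod (volume.restrict Ω)
      = -∫ p, (θ n p.2 - 1) * F p ∂μ.prod (volume.restrict Ω) := fun n => by
    rw [eq_neg_iff_add_eq_zero, ← integral_add (hgi n) (hFni n), hibp n]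
  simp_rw [heq]
  rw [← neg_zero]
  refine Tendsto.neg ?_
  have hdom := tendsto_integral_of_dominated_convergence (μ := μ.prod (volume.restrict Ω))
    (F := fun n p => (θ n p.2 - 1) * F p) (f := fun _ => 0) (fun p => ‖F p‖)
    (fun n => (hFni n).1) hFi.norm
    (fun n => Eventually.of_forall fun p => by
      rw [norm_mul]
      exact mul_le_of_le_one_left (norm_nonneg _) (hθ1 n p.2)) ?_
  · simpa using hdom
  · filter_upwards [Measure.quasiMeasurePreserving_snd.ae hlim] with p hp
    simpa using (hp.sub_const 1).mul_const (F p)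

theorem tendsto_integral_mul_of_dense {X : Type*} [NormedAddCommGroup X] [NormedSpace ℝ X]
    [FiniteDimensional ℝ X] [MeasurableSpace X] [BorelSpace X] {ν : Measure X} [IsFiniteMeasure ν]
    {D : ℕ → X → ℝ} (hD : ∀ n, AEStronglyMeasurable (D n) ν) {C : ℝ≥0∞} (hC : C ≠ ⊤)
    (hDC : ∀ n, ∫⁻ x, ‖D n x‖ₑ ^ 2 ∂ν ≤ C)
    (hlim : ∀ g : X → ℝ, ContDiff ℝ (⊤ : ℕ∞) g → HasCompactSupport g →
      Tendsto (fun n => ∫ x, g x * D n x ∂ν) atTop (𝓝 0))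
    {r : X → ℝ} (hr : MemLp r 2 ν) :
    Tendsto (fun n => ∫ x, r x * D n x ∂ν) atTop (𝓝 0) := by
  have hD2 : ∀ n, MemLp (D n) 2 ν := fun n =>
    (memLp_two_iff_lintegral (hD n)).2 ((hDC n).trans_lt hC.lt_top)
  have hDn : ∀ n, eLpNorm (D n) 2 ν ≤ C ^ (1 / 2 : ℝ) := fun n => by
    rw [eLpNorm_two_eq_lintegral_rpow]
    gcongr
    exact hDC n
  set M := (C ^ (1 / 2 : ℝ)).toReal with hM
  have hCr : C ^ (1 / 2 : ℝ) ≠ ⊤ := by finiteness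
  rw [Metric.tendsto_atTop]
  intro ε hε
  have hδ : 0 < ε / (2 * (M + 1)) := by positivity
  obtain ⟨g, hgs, hg, hgr⟩ := hr.exist_eLpNorm_sub_le (by norm_num) (by norm_num) hδ
  have hg2 : MemLp g 2 ν := hg.continuous.memLp_of_hasCompactSupport hgs
  obtain ⟨n₀, hn₀⟩ := (Metric.tendsto_atTop.1 (hlim g hg hgs)) (ε / 2) (by positivity)
  refine ⟨n₀, fun n hn => ?_⟩
  have h1 := hn₀ n hn
  rw [dist_zero_right] at h1 ⊢
  have hsplit : ∫ x, r x * D n x ∂ν = ∫ x, (r - g) x * D n x ∂ν + ∫ x, g x * D n x ∂ν := by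
    refine Eq.trans ?_ (integral_add ((hr.sub hg2).integrable_mul (hD2 n))
      (hg2.integrable_mul (hD2 n)))
    simp [sub_mul]
  have h2 : ‖∫ x, (r - g) x * D n x ∂ν‖ ≤ ε / (2 * (M + 1)) * M := by
    rw [← ENNReal.ofReal_le_ofReal_iff (by positivity), ofReal_norm,
      ENNReal.ofReal_mul hδ.le, hM, ENNReal.ofReal_toReal hCr]
    calc _ ≤ ∫⁻ x, ‖(r - g) x * D n x‖ₑ ∂ν := enorm_integral_le_lintegral_enorm _
      _ = eLpNorm ((r - g) • D n) 1 ν := by rw [eLpNorm_one_eq_lintegral_enorm]; rfl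
      _ ≤ eLpNorm (r - g) 2 ν * eLpNorm (D n) 2 ν :=
        eLpNorm_smul_le_mul_eLpNorm (hD n) (hr.sub hg2).1
      _ ≤ _ := mul_le_mul' hgr (hDn n)
  have h3 : ε / (2 * (M + 1)) * M < ε / 2 := by
    have : 0 ≤ M := ENNReal.toReal_nonneg
    rw [div_mul_eq_mul_div, div_lt_div_iff₀ (by positivity) (by positivity)]
    nlinarith
  rw [hsplit]
  linarith [norm_add_le (∫ x, (r - g) x * D n x ∂ν) (∫ x, g x * D n x ∂ν)]

/-- **Zero extension of weak solutions of the continuity equation.** If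
`∂ₜρ + div(ρu) = f` holds in `𝒟'((0,T)×Ω)`, with `ρ ∈ L²`, `f ∈ L¹`,
`u(t,·) ∈ W₀^{1,2}(Ω;ℝᴺ)` for a.e. `t` and `∫₀ᵀ∫_Ω |u|² + |Du|² < ∞`, then the
extensions of `ρ, u, f` by zero satisfy the same equation in `𝒟'((0,T)×ℝᴺ)`. -/
theorem continuity_equation_zero_extension
    (N : ℕ) (hN : 2 ≤ N)
    (Ω : Set (EuclideanSpace ℝ (Fin N))) (hΩ_open : IsOpen Ω)
    (hΩ_bdd : Bornology.IsBounded Ω)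
    (T : ℝ) (hT : 0 < T)
    (ρ f : ℝ → EuclideanSpace ℝ (Fin N) → ℝ)
    (u : ℝ → EuclideanSpace ℝ (Fin N) → EuclideanSpace ℝ (Fin N))
    (Du : ℝ → EuclideanSpace ℝ (Fin N) →
      (EuclideanSpace ℝ (Fin N) →L[ℝ] EuclideanSpace ℝ (Fin N)))
    (hρ_meas : Measurable fun p : ℝ × EuclideanSpace ℝ (Fin N) => ρ p.1 p.2)
    (hf_meas : Measurable fun p : ℝ × EuclideanSpace ℝ (Fin N) => f p.1 p.2)
    (hu_meas : Measurable fun p : ℝ × EuclideanSpace ℝ (Fin N) => u p.1 p.2)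
    (hDu_meas : Measurable fun p : ℝ × EuclideanSpace ℝ (Fin N) => Du p.1 p.2)
    -- `ρ ∈ L²((0,T)×Ω)`
    (hρ_L2 : (∫⁻ p in Set.Ioo 0 T ×ˢ Ω, ENNReal.ofReal ((ρ p.1 p.2) ^ 2)) < ⊤)
    -- `f ∈ L¹((0,T)×Ω)`
    (hf_L1 : (∫⁻ p in Set.Ioo 0 T ×ˢ Ω, ENNReal.ofReal |f p.1 p.2|) < ⊤)
    -- `u(t,·) ∈ W₀^{1,2}(Ω;ℝᴺ)` for a.e. `t ∈ (0,T)`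
    (hu_W012 : ∀ᵐ t ∂volume.restrict (Set.Ioo 0 T), MemW012 Ω (u t) (Du t))
    -- `∫₀ᵀ ∫_Ω |u|² + |Du|² dx dt < ∞`
    (hu_L2 : (∫⁻ p in Set.Ioo 0 T ×ˢ Ω,
        ENNReal.ofReal (‖u p.1 p.2‖ ^ 2 + ‖Du p.1 p.2‖ ^ 2)) < ⊤)
    -- `∂ₜρ + div(ρu) = f` in `𝒟'((0,T)×Ω)`
    (hweak : ∀ ψ : ℝ × EuclideanSpace ℝ (Fin N) → ℝ,
      ContDiff ℝ (⊤ : ℕ∞) ψ → HasCompactSupport ψ → tsupport ψ ⊆ Set.Ioo 0 T ×ˢ Ω →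
      ∫ t in Set.Ioo 0 T, ∫ x in Ω,
          (ρ t x * deriv (fun s => ψ (s, x)) t
            + ρ t x * (fderiv ℝ (fun y => ψ (t, y)) x (u t x))
            + f t x * ψ (t, x)) = 0) :
    -- `∂ₜρ̃ + div(ρ̃ũ) = f̃` in `𝒟'((0,T)×ℝᴺ)`
    ∀ ψ : ℝ × EuclideanSpace ℝ (Fin N) → ℝ,
      ContDiff ℝ (⊤ : ℕ∞) ψ → HasCompactSupport ψ →
      tsupport ψ ⊆ Set.Ioo 0 T ×ˢ Set.univ →
      ∫ t in Set.Ioo 0 T, ∫ x,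
          (Set.indicator Ω (ρ t) x * deriv (fun s => ψ (s, x)) t
            + Set.indicator Ω (ρ t) x *
                (fderiv ℝ (fun y => ψ (t, y)) x (Set.indicator Ω (u t) x))
            + Set.indicator Ω (f t) x * ψ (t, x)) = 0 := by
  intro ψ hψ hψs hψT
  have hΩm := hΩ_open.measurableSet
  have : IsFiniteMeasure (volume.restrict Ω) :=
    isFiniteMeasure_restrict.2 hΩ_bdd.measure_lt_top.ne
  have hΩc : Ωᶜ.Nonempty := by
    have : NeZero N := ⟨by lia⟩
    rw [Set.nonempty_compl]
    rintro rfl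
    exact NormedSpace.unbounded_univ ℝ (EuclideanSpace ℝ (Fin N)) hΩ_bdd
  set μ := (volume : Measure ℝ).restrict (Set.Ioo 0 T) with hμ
  have hν : (volume : Measure (ℝ × EuclideanSpace ℝ (Fin N))).restrict (Set.Ioo 0 T ×ˢ Ω)
      = μ.prod (volume.restrict Ω) := by
    rw [Measure.volume_eq_prod, hμ, Measure.prod_restrict]
  rw [hν] at hρ_L2 hf_L1 hu_L2
  set ν := μ.prod (volume.restrict Ω) with hνdef
  have hρ2 : MemLp (fun p : ℝ × EuclideanSpace ℝ (Fin N) => ρ p.1 p.2) 2 ν := by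
    rw [memLp_two_iff_lintegral hρ_meas.aestronglyMeasurable]
    refine (lintegral_congr fun p => ?_).trans_lt hρ_L2
    rw [← ofReal_norm, ← ENNReal.ofReal_pow (norm_nonneg _), Real.norm_eq_abs, sq_abs]
  have hf1 : Integrable (fun p : ℝ × EuclideanSpace ℝ (Fin N) => f p.1 p.2) ν := by
    refine ⟨hf_meas.aestronglyMeasurable, ?_⟩
    rw [hasFiniteIntegral_iff_norm]
    simpa only [Real.norm_eq_abs] using hf_L1
  have huDu : ∫⁻ p, (‖u p.1 p.2‖ₑ ^ 2 + ‖Du p.1 p.2‖ₑ ^ 2) ∂ν < ⊤ := by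
    refine (lintegral_congr fun p => ?_).trans_lt hu_L2
    rw [ENNReal.ofReal_add (by positivity) (by positivity), ENNReal.ofReal_pow (norm_nonneg _),
      ENNReal.ofReal_pow (norm_nonneg _), ofReal_norm, ofReal_norm]
  have hu2 : MemLp (fun p : ℝ × EuclideanSpace ℝ (Fin N) => u p.1 p.2) 2 ν :=
    (memLp_two_iff_lintegral hu_meas.aestronglyMeasurable).2
      ((lintegral_mono fun _ => le_self_add).trans_lt huDu)
  have hDu2 : MemLp (fun p : ℝ × EuclideanSpace ℝ (Fin N) => Du p.1 p.2) 2 ν :=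
    (memLp_two_iff_lintegral hDu_meas.aestronglyMeasurable).2
      ((lintegral_mono fun _ => le_add_self).trans_lt huDu)
  have hfin : ∫⁻ t, sobolevEnergy Ω (u t) (Du t) ∂μ < ⊤ :=
    (lintegral_prod _
      ((hu_meas.enorm.pow_const 2).add (hDu_meas.enorm.pow_const 2)).aemeasurable).symm.trans_lt
      huDu
  obtain ⟨C, θ, hC, hθ, hθC, hθlim⟩ :=
    exists_cutoff_seq hΩ_open hΩ_bdd hΩc hu_meas hDu_meas hu_W012 hfin
  have hθ1 : ∀ n, ContDiff ℝ 1 (θ n) := fun n => (hθ n).1.of_le (by exact_mod_cast le_top)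
  have hψ1 : ContDiff ℝ 1 ψ := hψ.of_le (by exact_mod_cast le_top)
  have hψd : Differentiable ℝ ψ := hψ1.differentiable one_ne_zero
  have hψc : Continuous (fderiv ℝ ψ) := hψ1.continuous_fderiv one_ne_zero
  obtain ⟨K, hK⟩ := hψs.exists_bound_of_continuous hψ.continuous
  obtain ⟨K', hK'⟩ := (hψs.fderiv ℝ).exists_bound_of_continuous hψc
  set a : ℝ × EuclideanSpace ℝ (Fin N) → ℝ := fun p =>
    ρ p.1 p.2 * fderiv ℝ ψ p (1, 0) + ρ p.1 p.2 * fderiv ℝ ψ p (0, u p.1 p.2)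
      + f p.1 p.2 * ψ p with ha
  have hDψ : ∀ {v : ℝ × EuclideanSpace ℝ (Fin N) → ℝ × EuclideanSpace ℝ (Fin N)},
      MemLp v 2 ν → MemLp (fun p => fderiv ℝ ψ p (v p)) 2 ν := fun hv =>
    hv.of_le_mul (c := K') (isBoundedBilinearMap_apply.continuous.comp_aestronglyMeasurable
      (hψc.aestronglyMeasurable.prodMk hv.1)) (Eventually.of_forall fun p =>
        ((fderiv ℝ ψ p).le_opNorm _).trans (by gcongr; exact hK' p))
  have hu0 : MemLp (fun p : ℝ × EuclideanSpace ℝ (Fin N) => ((0 : ℝ), u p.1 p.2)) 2 ν :=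
    hu2.of_le (aestronglyMeasurable_const.prodMk hu2.1)
      (Eventually.of_forall fun p => by simp [Prod.norm_mk])
  have hai : Integrable a ν :=
    ((hρ2.integrable_mul (hDψ (memLp_const _))).add (hρ2.integrable_mul (hDψ hu0))).add
      (hf1.mul_bdd hψ.continuous.aestronglyMeasurable (Eventually.of_forall hK))
  have hgoal : ∫ p, a p ∂ν = 0 := by
    have hDm : ∀ n, AEStronglyMeasurable
        (fun p : ℝ × EuclideanSpace ℝ (Fin N) => fderiv ℝ (θ n) p.2 (u p.1 p.2)) ν := fun n =>
      isBoundedBilinearMap_apply.continuous.comp_aestronglyMeasurable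
        ((((hθ1 n).continuous_fderiv one_ne_zero).comp continuous_snd).aestronglyMeasurable.prodMk
          hu2.1)
    have hDC : ∀ n, ∫⁻ p, ‖fderiv ℝ (θ n) p.2 (u p.1 p.2)‖ₑ ^ 2 ∂ν ≤ C := fun n => by
      rw [hνdef, lintegral_prod_symm _ ((hDm n).enorm.pow_const 2)]
      refine (lintegral_mono fun x => ?_).trans (hθC n)
      have hux : Measurable fun t => u t x := hu_meas.comp measurable_prodMk_right
      rw [← lintegral_mul_const _ (hux.enorm.pow_const 2)]
      refine lintegral_mono fun t => ?_
      rw [← mul_pow, mul_comm]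
      exact pow_le_pow_left' ((fderiv ℝ (θ n) x).le_opENorm (u t x)) 2
    have hr : MemLp (fun p : ℝ × EuclideanSpace ℝ (Fin N) => ρ p.1 p.2 * ψ p) 2 ν :=
      hρ2.of_le_mul (c := K) (hρ2.1.mul hψ.continuous.aestronglyMeasurable)
        (Eventually.of_forall fun p => by
          rw [norm_mul, mul_comm]
          gcongr
          exact hK p)
    have hlim := tendsto_integral_mul_of_dense hDm hC hDC
      (fun g hg hgs => tendsto_integral_mul_fderiv_cutoff hu_W012 hu_meas hDu_meas hu2 hDu2 hθ1
        (fun n => (hθ n).2.1) (fun n => (hθ n).2.2.2) hθlim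
        (hg.of_le (by exact_mod_cast le_top)) hgs) hr
    have hθb : ∀ n x, ‖θ n x‖ ≤ 1 := fun n x => by
      obtain ⟨h0, h1⟩ := (hθ n).2.2.2 x
      rwa [Real.norm_of_nonneg h0]
    have hai' : ∀ n, Integrable (fun p : ℝ × EuclideanSpace ℝ (Fin N) => θ n p.2 * a p) ν :=
      fun n => hai.bdd_mul ((hθ1 n).continuous.comp continuous_snd).aestronglyMeasurable
        (Eventually.of_forall fun p => hθb n p.2)
    have hlim' : Tendsto (fun n => ∫ p, θ n p.2 * a p ∂ν) atTop (𝓝 (∫ p, a p ∂ν)) := by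
      refine tendsto_integral_of_dominated_convergence (fun p => ‖a p‖) (fun n => (hai' n).1)
        hai.norm (fun n => Eventually.of_forall fun p => ?_) ?_
      · rw [norm_mul]
        exact mul_le_of_le_one_left (norm_nonneg _) (hθb n p.2)
      · filter_upwards [Measure.quasiMeasurePreserving_snd.ae hθlim] with p hp
        simpa using hp.mul_const (a p)
    have hDi : ∀ n, Integrable (fun p : ℝ × EuclideanSpace ℝ (Fin N) =>
        ρ p.1 p.2 * ψ p * fderiv ℝ (θ n) p.2 (u p.1 p.2)) ν := fun n =>
      hr.integrable_mul ((memLp_two_iff_lintegral (hDm n)).2 ((hDC n).trans_lt hC.lt_top))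
    refine tendsto_nhds_unique (by simpa using hlim'.add hlim)
      (tendsto_const_nhds.congr fun n => ?_)
    rw [← integral_add (hai' n) (hDi n), eq_comm]
    refine (integral_prod _ ((hai' n).add (hDi n))).trans ?_
    have hsupp : tsupport (fun p : ℝ × EuclideanSpace ℝ (Fin N) => ψ p * θ n p.2)
        ⊆ Set.Ioo 0 T ×ˢ Ω := fun p hp =>
      ⟨(hψT (tsupport_mul_subset_left hp)).1, (hθ n).2.2.1
        (tsupport_comp_subset_preimage (θ n) continuous_snd (tsupport_mul_subset_right hp))⟩
    rw [← hweak _ (hψ.mul ((hθ n).1.comp contDiff_snd)) hψs.mul_right hsupp]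
    refine integral_congr_ae (Eventually.of_forall fun t => integral_congr_ae
      (Eventually.of_forall fun x => ?_))
    have hψt : DifferentiableAt ℝ (fun y => ψ (t, y)) x :=
      (hψ1.comp (contDiff_prodMk_right t)).differentiable one_ne_zero x
    simp only [Pi.add_apply, Function.comp_apply, ha, deriv_mul_const_field, deriv_prodMk_right hψd,
      fderiv_fun_mul hψt ((hθ1 n).differentiable one_ne_zero x), add_apply, smul_apply,
      smul_eq_mul, fderiv_prodMk_left hψd]
    ring
  rw [← hgoal, hνdef, integral_prod _ hai]
  refine integral_congr_ae (Eventually.of_forall fun t => ?_)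
  simp only
  rw [← integral_indicator hΩm]
  refine integral_congr_ae (Eventually.of_forall fun x => ?_)
  by_cases hx : x ∈ Ω
  · simp only [hx, Set.indicator_of_mem, ha, deriv_prodMk_right hψd, fderiv_prodMk_left hψd]
  · simp [hx]
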